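/- arXiv:math/0302302 — 3 statements merged into one kernel-verified Lean document; each statement's English description precedes it below -/
import Mathlib

section
/- The free energy of ternary square-free words is bounded below by F(q) ≥ max{ (64/233) log q, (13/36) log q } for all q > 0. -/
/-- A word `w` is square-free if whenever `w = x ++ y ++ y ++ z`,
then `y` is the empty word. -/
def SquareFree {α : Type*} (w : List α) : Prop :=
  ∀ x y z : List α, w = x ++ y ++ y ++ z → y = []

/-- `s2 n k` is the number of ternary square-free words of length `n`
containing exactly `k` occurrences of the letter `a` (here `0 : Fin 3`). -/
noncomputable def s2 (n k : ℕ) : ℕ :=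
  Nat.card {w : List (Fin 3) // w.length = n ∧ SquareFree w ∧ w.count 0 = k}

/-- The weighted counting polynomial `s_n(q) = Σ_{k=0}^{n} s_{n,k} q^k`. -/
noncomputable def sPoly (n : ℕ) (q : ℝ) : ℝ :=
  ∑ k ∈ Finset.range (n + 1), (s2 n k : ℝ) * q ^ k

/-! ### Square-free words as functions -/

/-- The word `f 0, …, f (n-1)` contains no square. -/
def SqFn (f : ℕ → Fin 3) (n : ℕ) : Prop :=
  ∀ i p, 0 < p → i + 2 * p ≤ n → ∃ j, j < p ∧ f (i + j) ≠ f (i + j + p)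

/-- Letters coded by two bit masks. -/
def letterOf (a b : ℕ) (j : ℕ) : Fin 3 :=
  if a.testBit j then 0 else if b.testBit j then 1 else 2

/-- The image of a word under an `L`-uniform morphism given by masks. -/
def imageWord (A B : Fin 3 → ℕ) (L : ℕ) (f : ℕ → Fin 3) (i : ℕ) : Fin 3 :=
  letterOf (A (f (i / L))) (B (f (i / L))) (i % L)

/-- `q j` for every `j < n`. -/
def allBelow (q : ℕ → Bool) : ℕ → Bool
  | 0 => true
  | n + 1 => q n && allBelow q n

/-- `q j` for some `j < n`. -/
def anyBelow (q : ℕ → Bool) : ℕ → Bool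
  | 0 => false
  | n + 1 => q n || anyBelow q n

/-- number of `j < n` with `q j`. -/
def numBelow (q : ℕ → Bool) : ℕ → ℕ
  | 0 => 0
  | n + 1 => numBelow q n + (q n).toNat

/-- number of `j < 2 ^ d` with `q (s + j)`, computed by bisection. -/
def numTree (q : ℕ → Bool) : ℕ → ℕ → ℕ
  | 0, s => (q s).toNat
  | d + 1, s => numTree q d s + numTree q d (s + 2 ^ d)

theorem numBelow_add (q : ℕ → Bool) (a b : ℕ) :
    numBelow q (a + b) = numBelow q a + numBelow (fun j => q (a + j)) b := by
  induction b with
  | zero => simp [numBelow]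
  | succ b ih => rw [← add_assoc]; simp only [numBelow, ih]; omega

theorem numTree_eq (q : ℕ → Bool) (d : ℕ) : ∀ s,
    numTree q d s = numBelow (fun j => q (s + j)) (2 ^ d) := by
  induction d with
  | zero => intro s; simp [numTree, numBelow]
  | succ d ih =>
    intro s
    rw [pow_succ, mul_two, numBelow_add, numTree, ih, ih]
    simp only [add_assoc]

theorem numBelow_false {q : ℕ → Bool} {n : ℕ} (h : ∀ j, q j = false) : numBelow q n = 0 := by
  induction n with
  | zero => rfl
  | succ n ih => simp [numBelow, ih, h]

theorem allBelow_spec {q : ℕ → Bool} {n : ℕ} (h : allBelow q n = true) :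
    ∀ j, j < n → q j = true := by
  induction n with
  | zero => intro j hj; omega
  | succ n ih =>
    simp only [allBelow, Bool.and_eq_true] at h
    intro j hj
    rcases Nat.lt_succ_iff_lt_or_eq.mp hj with h1 | h1
    · exact ih h.2 j h1
    · exact h1 ▸ h.1

theorem anyBelow_spec {q : ℕ → Bool} {n : ℕ} (h : anyBelow q n = true) :
    ∃ j, j < n ∧ q j = true := by
  induction n with
  | zero => simp [anyBelow] at h
  | succ n ih =>
    simp only [anyBelow, Bool.or_eq_true] at h
    rcases h with h | h
    · exact ⟨n, by omega, h⟩
    · obtain ⟨j, hj, hq⟩ := ih h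
      exact ⟨j, by omega, hq⟩

/-- Disjunction of `k` consecutive shifts of `M`, by repeated halving. -/
def orRun (M : ℕ) : ℕ → ℕ → ℕ
  | 0, _ => M
  | d + 1, k => orRun M d ((k + 1) / 2) ||| (orRun M d ((k + 1) / 2) >>> (k - (k + 1) / 2))

theorem orRun_spec (M d : ℕ) : ∀ k i, 0 < k → (orRun M d k).testBit i = true →
    ∃ j, j < k ∧ M.testBit (i + j) = true := by
  induction d with
  | zero => intro k i hk h; exact ⟨0, hk, h⟩
  | succ d ih =>
    intro k i hk h
    simp only [orRun, Nat.testBit_or, Nat.testBit_shiftRight, Bool.or_eq_true] at h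
    rcases h with h | h
    · obtain ⟨j, hj, hM⟩ := ih _ _ (by omega) h
      exact ⟨j, by omega, hM⟩
    · obtain ⟨j, hj, hM⟩ := ih _ _ (by omega) h
      refine ⟨k - (k + 1) / 2 + j, by omega, ?_⟩
      rw [← hM]; congr 1; omega

/-- Mismatch mask of a word with its shift by `p`. -/
def mism (a b p : ℕ) : ℕ := (a ^^^ (a >>> p)) ||| (b ^^^ (b >>> p))

/-- No square of period `p` in the word of length `n` coded by `a`, `b`. -/
def noPeriod (a b n p : ℕ) : Bool :=
  Nat.beq (orRun (mism a b p) 10 p % 2 ^ (n + 1 - 2 * p)) (2 ^ (n + 1 - 2 * p) - 1)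

theorem noPeriod_spec {a b n p : ℕ} (hp : 0 < p) (h : noPeriod a b n p = true)
    (i : ℕ) (hi : i + 2 * p ≤ n) :
    ∃ j, j < p ∧ (a.testBit (i + j) ≠ a.testBit (i + j + p) ∨
      b.testBit (i + j) ≠ b.testBit (i + j + p)) := by
  have h1 := Nat.eq_of_beq_eq_true h
  have h2 := congrArg (fun t => t.testBit i) h1
  simp only [Nat.testBit_mod_two_pow, Nat.testBit_two_pow_sub_one] at h2
  have h3 : i < n + 1 - 2 * p := by omega
  simp only [h3, decide_true, Bool.true_and] at h2
  obtain ⟨j, hj, hM⟩ := orRun_spec _ _ _ _ hp h2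
  refine ⟨j, hj, ?_⟩
  simp only [mism, Nat.testBit_or, Nat.testBit_xor, Nat.testBit_shiftRight, Bool.or_eq_true,
    bne_iff_ne, Nat.add_comm p] at hM
  exact hM

/-- Concatenation of four blocks. -/
def cat4 (L a b c d : ℕ) : ℕ := a ||| (b <<< L) ||| (c <<< (2 * L)) ||| (d <<< (3 * L))

theorem cat4_testBit {L : ℕ} (hL : 0 < L) (g : ℕ → ℕ) (hg : ∀ k, g k < 2 ^ L) (i : ℕ)
    (hi : i < 4 * L) :
    (cat4 L (g 0) (g 1) (g 2) (g 3)).testBit i = (g (i / L)).testBit (i % L) := by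
  have hz : ∀ k t, L ≤ t → (g k).testBit t = false := fun k t ht =>
    Nat.testBit_lt_two_pow (lt_of_lt_of_le (hg k) (Nat.pow_le_pow_right (by norm_num) ht))
  have hq : i / L < 4 := by rw [Nat.div_lt_iff_lt_mul hL]; omega
  have hm := Nat.mod_lt i hL
  have hd := Nat.div_add_mod i L
  generalize i / L = k at *
  generalize i % L = r at *
  subst hd
  simp only [cat4, Nat.testBit_or, Nat.testBit_shiftLeft]
  interval_cases k
  · have e1 : ¬ (L ≤ r) := by omega
    have e2 : ¬ (2 * L ≤ r) := by omega
    have e3 : ¬ (3 * L ≤ r) := by omega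
    simp [e1, e2, e3]
  · have e2 : ¬ (2 * L ≤ L + r) := by omega
    have e3 : ¬ (3 * L ≤ L + r) := by omega
    simp [e2, e3, hz 0 (L + r) (by omega)]
  · have e3 : ¬ (3 * L ≤ L * 2 + r) := by omega
    have e2 : (2 * L ≤ L * 2 + r) := by omega
    have e1 : (L ≤ L * 2 + r) := by omega
    have f2 : L * 2 + r - 2 * L = r := by omega
    simp [e1, e2, e3, f2, hz 0 (L * 2 + r) (by omega), hz 1 (L * 2 + r - L) (by omega)]
  · have e3 : (3 * L ≤ L * 3 + r) := by omega
    have e2 : (2 * L ≤ L * 3 + r) := by omega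
    have e1 : (L ≤ L * 3 + r) := by omega
    have f3 : L * 3 + r - 3 * L = r := by omega
    simp [e1, e2, e3, f3, hz 0 (L * 3 + r) (by omega), hz 1 (L * 3 + r - L) (by omega),
      hz 2 (L * 3 + r - 2 * L) (by omega)]

/-- Boolean test for two letters being different. -/
def neB (x y : Fin 3) : Bool := !(Nat.beq x.val y.val)

theorem neB_iff {x y : Fin 3} : neB x y = true ↔ x ≠ y := by
  revert x y; decide

/-- check that short periods do not occur in images of words of length four -/
def checkShort (A B : Fin 3 → ℕ) (L P : ℕ) (x y z t : Fin 3) : Bool :=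
  allBelow (fun p => noPeriod (cat4 L (A x) (A y) (A z) (A t))
    (cat4 L (B x) (B y) (B z) (B t)) (4 * L) (p + 1)) P

/-- check that the marker occurs in the images of two-letter words only at offset `o` -/
def checkMark (A B : Fin 3 → ℕ) (L m o : ℕ) (x y : Fin 3) : Bool :=
  allBelow (fun s => Nat.beq s o || anyBelow (fun j =>
    neB (letterOf (cat4 L (A x) (A y) 0 0) (cat4 L (B x) (B y) 0 0) (s + j))
      (letterOf (A 0) (B 0) (o + j))) m) L

/-- All the properties of the morphism that are verified by computation. -/
structure Good (A B : Fin 3 → ℕ) (L m o c N : ℕ) : Prop where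
  hm : 0 < m
  hmL : 2 * m ≤ L + 5
  hmo : o + m ≤ L
  hcL : c ≤ L
  ltA : ∀ x, A x < 2 ^ L
  ltB : ∀ x, B x < 2 ^ L
  disj : ∀ x, A x &&& B x = 0
  hd : L ≤ 2 ^ 10
  numT : ∀ x, numTree (A x).testBit 10 0 = N
  mark : ∀ x, allBelow (fun j => !(neB (letterOf (A x) (B x) (o + j))
    (letterOf (A 0) (B 0) (o + j)))) m = true
  pre : ∀ x y, x ≠ y → anyBelow (fun j => neB (letterOf (A x) (B x) j)
    (letterOf (A y) (B y) j)) c = true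
  suf : ∀ x y, x ≠ y → anyBelow (fun j => neB (letterOf (A x) (B x) (c + j))
    (letterOf (A y) (B y) (c + j))) (L - c) = true
  uniq : ∀ x y, x ≠ y → checkMark A B L m o x y = true
  short : ∀ x y z t, x ≠ y → y ≠ z → z ≠ t → checkShort A B L (L + m - 2) x y z t = true

theorem letterOf_ne {a b a' b' j j' : ℕ} (h : a &&& b = 0) (h' : a' &&& b' = 0)
    (hne : a.testBit j ≠ a'.testBit j' ∨ b.testBit j ≠ b'.testBit j') :
    letterOf a b j ≠ letterOf a' b' j' := by
  have e := congrArg (fun t => t.testBit j) h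
  have e' := congrArg (fun t => t.testBit j') h'
  simp only [Nat.testBit_and, Nat.zero_testBit] at e e'
  unfold letterOf
  revert e e' hne
  cases a.testBit j <;> cases b.testBit j <;> cases a'.testBit j' <;> cases b'.testBit j' <;>
    simp

section
variable {A B : Fin 3 → ℕ} {L m o c N : ℕ}

theorem imageWord_eq (hL : 0 < L) (f : ℕ → Fin 3) (k r : ℕ) (hr : r < L) :
    imageWord A B L f (L * k + r) = letterOf (A (f k)) (B (f k)) r := by
  unfold imageWord
  rw [Nat.mul_add_div hL, Nat.mul_add_mod, Nat.div_eq_of_lt hr, Nat.mod_eq_of_lt hr, add_zero]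

theorem image_short (G : Good A B L m o c N) (f : ℕ → Fin 3) (hf : ∀ k, f k ≠ f (k + 1))
    (i p : ℕ) (hp : 0 < p) (hpP : p ≤ L + m - 2) :
    ∃ j, j < p ∧ imageWord A B L f (i + j) ≠ imageWord A B L f (i + j + p) := by
  have hL : 0 < L := by have := G.hm; have := G.hmo; omega
  have hm := G.hm
  have hmL := G.hmL
  have hr := Nat.mod_lt i hL
  have hd := Nat.div_add_mod i L
  generalize i / L = k at *
  generalize i % L = r at *
  have hs := G.short (f (k + 0)) (f (k + 1)) (f (k + 2)) (f (k + 3)) (hf _) (hf _) (hf _)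
  have h1 := allBelow_spec hs (p - 1) (by omega)
  simp only [Nat.sub_add_cancel hp] at h1
  obtain ⟨j, hj, hne⟩ := noPeriod_spec hp h1 r (by omega)
  have hcatA := cat4_testBit hL (fun s => A (f (k + s))) (fun s => G.ltA _)
  have hcatB := cat4_testBit hL (fun s => B (f (k + s))) (fun s => G.ltB _)
  rw [hcatA _ (by omega), hcatA _ (by omega), hcatB _ (by omega), hcatB _ (by omega)] at hne
  refine ⟨j, hj, ?_⟩
  have key : ∀ t, imageWord A B L f (L * k + t) =
      letterOf (A (f (k + t / L))) (B (f (k + t / L))) (t % L) := by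
    intro t
    conv_lhs => rw [← Nat.div_add_mod t L, ← add_assoc, ← Nat.mul_add]
    exact imageWord_eq hL f _ _ (Nat.mod_lt _ hL)
  rw [← hd, add_assoc (L * k) r j, add_assoc (L * k) (r + j) p, key, key]
  exact letterOf_ne (G.disj _) (G.disj _) hne

theorem image_adj (G : Good A B L m o c N) (hL2 : 2 ≤ L) (f : ℕ → Fin 3)
    (hf : ∀ k, f k ≠ f (k + 1)) (k : ℕ) :
    imageWord A B L f k ≠ imageWord A B L f (k + 1) := by
  have hm := G.hm
  obtain ⟨j, hj, h⟩ := image_short G f hf k 1 (by norm_num) (by omega)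
  have : j = 0 := by omega
  subst this
  exact h

theorem image_mark (G : Good A B L m o c N) (f : ℕ → Fin 3) (k j : ℕ) (hj : j < m) :
    imageWord A B L f (L * k + (o + j)) = letterOf (A 0) (B 0) (o + j) := by
  have hmo := G.hmo
  rw [imageWord_eq (by omega) f _ _ (by omega)]
  have := allBelow_spec (G.mark (f k)) j hj
  by_contra hne
  rw [neB_iff.mpr hne] at this
  simp at this

theorem image_uniq (G : Good A B L m o c N) (f : ℕ → Fin 3) (hf : ∀ k, f k ≠ f (k + 1)) (k s : ℕ)
    (hs : s < L)
    (h : ∀ j, j < m → imageWord A B L f (L * k + (s + j)) = letterOf (A 0) (B 0) (o + j)) :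
    s = o := by
  have hmo := G.hmo
  have hm := G.hm
  have hL : 0 < L := by omega
  have h1 := allBelow_spec (G.uniq (f k) (f (k + 1)) (hf k)) s hs
  simp only [Bool.or_eq_true] at h1
  rcases h1 with h1 | h1
  · exact Nat.eq_of_beq_eq_true h1
  · exfalso
    obtain ⟨j, hj, hne⟩ := anyBelow_spec h1
    rw [neB_iff] at hne
    apply hne
    rw [← h j hj]
    have hcA := cat4_testBit hL (fun t => if t = 0 then A (f k) else if t = 1 then A (f (k + 1))
      else 0) (fun t => by
        split_ifs
        exacts [G.ltA _, G.ltA _, Nat.two_pow_pos _]) (s + j) (by omega)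
    have hcB := cat4_testBit hL (fun t => if t = 0 then B (f k) else if t = 1 then B (f (k + 1))
      else 0) (fun t => by
        split_ifs
        exacts [G.ltB _, G.ltB _, Nat.two_pow_pos _]) (s + j) (by omega)
    simp only [if_true, OfNat.ofNat_ne_zero, OfNat.ofNat_ne_one, one_ne_zero, if_false] at hcA hcB
    have hq : (s + j) / L < 2 := by rw [Nat.div_lt_iff_lt_mul hL]; omega
    have hmod := Nat.mod_lt (s + j) hL
    have hd := Nat.div_add_mod (s + j) L
    rw [← hd, ← add_assoc, ← Nat.mul_add, imageWord_eq hL f _ _ hmod, hd]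
    unfold letterOf
    rw [hcA, hcB]
    generalize (s + j) / L = d at *
    have : d = 0 ∨ d = 1 := by omega
    rcases this with e | e
    · simp [e]
    · simp [e]

theorem image_inj_pre (G : Good A B L m o c N) (x y : Fin 3)
    (h : ∀ j, j < c → letterOf (A x) (B x) j = letterOf (A y) (B y) j) : x = y := by
  by_contra hne
  obtain ⟨j, hj, h1⟩ := anyBelow_spec (G.pre x y hne)
  exact neB_iff.mp h1 (h j hj)

theorem image_inj_suf (G : Good A B L m o c N) (x y : Fin 3)
    (h : ∀ j, c ≤ j → j < L → letterOf (A x) (B x) j = letterOf (A y) (B y) j) : x = y := by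
  by_contra hne
  obtain ⟨j, hj, h1⟩ := anyBelow_spec (G.suf x y hne)
  exact neB_iff.mp h1 (h (c + j) (by omega) (by omega))

/-- The morphism preserves square-freeness. -/
theorem image_sqFn (G : Good A B L m o c N) (f : ℕ → Fin 3)
    (hf : ∀ k, f k ≠ f (k + 1)) (n : ℕ) (hn : SqFn f n) :
    SqFn (imageWord A B L f) (L * n) := by
  intro i p hp hi
  have hmo := G.hmo
  have hm := G.hm
  have hcL := G.hcL
  have hL : 0 < L := by omega
  by_cases hsmall : p ≤ L + m - 2
  · exact image_short G f hf i p hp hsmall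
  by_contra hcon
  push Not at hcon
  have hr := Nat.mod_lt i hL
  have hd := Nat.div_add_mod i L
  generalize i / L = a at *
  generalize i % L = r at *
  -- the period is a multiple of `L`
  have hdvd : L ∣ p := by
    obtain ⟨b, hb1, hb2⟩ : ∃ b, i ≤ L * b + o ∧ L * b + o < i + L := by
      by_cases hro : r ≤ o
      · exact ⟨a, by omega, by omega⟩
      · exact ⟨a + 1, by rw [Nat.mul_add]; omega, by rw [Nat.mul_add]; omega⟩
    have hq := Nat.div_add_mod (L * b + o + p) L
    have hqm := Nat.mod_lt (L * b + o + p) hL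
    have h1 := image_uniq G f hf ((L * b + o + p) / L) ((L * b + o + p) % L) hqm (by
      intro j hj
      rw [← image_mark G f b j hj]
      have h2 := hcon (L * b + o - i + j) (by omega)
      have e1 : i + (L * b + o - i + j) = L * b + (o + j) := by omega
      rw [e1] at h2
      rw [h2]
      congr 1
      omega)
    rw [h1] at hq
    have h3 : L * ((L * b + o + p) / L) = L * b + p := by omega
    exact (Nat.dvd_add_right (Dvd.intro _ rfl)).mp (Dvd.intro _ h3)
  obtain ⟨k, rfl⟩ := hdvd
  have hk : 0 < k := Nat.pos_of_mul_pos_left hp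
  have hagree : ∀ b j, j < L → i ≤ L * b + j → L * b + j < i + L * k →
      letterOf (A (f b)) (B (f b)) j = letterOf (A (f (b + k))) (B (f (b + k))) j := by
    intro b j hj h1 h2
    have h3 := hcon (L * b + j - i) (by omega)
    have e1 : i + (L * b + j - i) = L * b + j := by omega
    have e2 : L * b + j + L * k = L * (b + k) + j := by rw [Nat.mul_add]; omega
    rw [e1, e2, imageWord_eq hL f _ _ hj, imageWord_eq hL f _ _ hj] at h3
    exact h3
  have hmid : ∀ b, a < b → b < a + k → f b = f (b + k) := by
    intro b h1 h2
    apply image_inj_pre G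
    intro j hj
    have h3 : L * (a + 1) ≤ L * b := Nat.mul_le_mul_left _ h1
    have h4 : L * (b + 1) ≤ L * (a + k) := Nat.mul_le_mul_left _ h2
    rw [Nat.mul_add] at h3 h4
    rw [Nat.mul_add] at h4
    exact hagree b j (by omega) (by omega) (by omega)
  by_cases hrc : r ≤ c
  · have hfa : f a = f (a + k) := by
      apply image_inj_suf G
      intro j h1 h2
      have h4 : L * 1 ≤ L * k := Nat.mul_le_mul_left _ hk
      exact hagree a j h2 (by omega) (by omega)
    have hb : a + 2 * k ≤ n := by
      have : L * (a + 2 * k) ≤ L * n := by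
        have : L * (a + 2 * k) = L * a + 2 * (L * k) := by ring
        omega
      exact Nat.le_of_mul_le_mul_left this hL
    obtain ⟨j, hj, hne⟩ := hn a k hk hb
    apply hne
    rcases Nat.eq_zero_or_pos j with rfl | hj0
    · exact hfa
    · exact hmid _ (by omega) (by omega)
  · have hfa : f (a + k) = f (a + k + k) := by
      apply image_inj_pre G
      intro j h1
      have h5 : L * (a + k) = L * a + L * k := Nat.mul_add _ _ _
      have h4 : L * 1 ≤ L * k := Nat.mul_le_mul_left _ hk
      exact hagree (a + k) j (by omega) (by omega) (by omega)
    have hb : a + 1 + 2 * k ≤ n := by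
      have : L * (a + 2 * k) < L * n := by
        have : L * (a + 2 * k) = L * a + 2 * (L * k) := by ring
        omega
      have := Nat.lt_of_mul_lt_mul_left this
      omega
    obtain ⟨j, hj, hne⟩ := hn (a + 1) k hk hb
    apply hne
    by_cases hj1 : j + 1 = k
    · have : a + 1 + j = a + k := by omega
      rw [this]; exact hfa
    · exact hmid _ (by omega) (by omega)

/-- Iterates of the morphism. -/
def iterWord (A B : Fin 3 → ℕ) (L : ℕ) : ℕ → ℕ → Fin 3
  | 0 => fun i => Fin.ofNat 3 i
  | k + 1 => imageWord A B L (iterWord A B L k)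

theorem iterWord_spec (G : Good A B L m o c N) (hL2 : 2 ≤ L) (k : ℕ) :
    (∀ i, iterWord A B L k i ≠ iterWord A B L k (i + 1)) ∧ SqFn (iterWord A B L k) (L ^ k) := by
  induction k with
  | zero =>
    constructor
    · intro i h
      have := congrArg Fin.val h
      simp only [iterWord, Fin.val_ofNat] at this
      omega
    · intro i p hp h
      simp only [pow_zero] at h
      omega
  | succ k ih =>
    refine ⟨image_adj G hL2 _ ih.1, ?_⟩
    rw [pow_succ, mul_comm]
    exact image_sqFn G _ ih.1 _ ih.2

/-! ### Counting the letter `a` -/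

theorem numBelow_congr {q q' : ℕ → Bool} {n : ℕ} (h : ∀ j, j < n → q j = q' j) :
    numBelow q n = numBelow q' n := by
  induction n with
  | zero => rfl
  | succ n ih =>
    simp only [numBelow]
    rw [ih (fun j hj => h j (by omega)), h n (by omega)]

theorem Good.num (G : Good A B L m o c N) (x : Fin 3) : numBelow (A x).testBit L = N := by
  have h := G.numT x
  have hd := G.hd
  rw [numTree_eq] at h
  simp only [zero_add] at h
  rw [← h]
  conv_rhs => rw [← Nat.add_sub_cancel' hd, numBelow_add]
  rw [numBelow_false (n := 2 ^ 10 - L) (fun j => Nat.testBit_lt_two_pow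
    (lt_of_lt_of_le (G.ltA x) (Nat.pow_le_pow_right (by norm_num) (by omega)))), add_zero]

theorem image_num (G : Good A B L m o c N) (f : ℕ → Fin 3) (n : ℕ) :
    numBelow (fun i => decide (imageWord A B L f i = 0)) (L * n) = N * n := by
  have hL : 0 < L := by have := G.hm; have := G.hmo; omega
  induction n with
  | zero => simp [numBelow]
  | succ n ih =>
    rw [Nat.mul_add, mul_one, numBelow_add, ih, Nat.mul_add, mul_one, ← G.num (f n)]
    congr 1
    apply numBelow_congr
    intro j hj
    rw [imageWord_eq hL f _ _ hj]
    unfold letterOf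
    cases (A (f n)).testBit j <;> cases (B (f n)).testBit j <;> simp

theorem count_map_range (f : ℕ → Fin 3) (n : ℕ) :
    ((List.range n).map f).count 0 = numBelow (fun i => decide (f i = 0)) n := by
  induction n with
  | zero => simp [numBelow]
  | succ n ih =>
    rw [List.range_succ, List.map_append, List.count_append, ih]
    simp only [numBelow, List.map_cons, List.map_nil, List.count_singleton]
    by_cases h : f n = 0 <;> simp [h]

theorem squareFree_of_sqFn (f : ℕ → Fin 3) (n : ℕ) (h : SqFn f n) :
    SquareFree ((List.range n).map f) := by
  intro x y z hw
  by_contra hy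
  have hpos : 0 < y.length := List.length_pos_iff.mpr hy
  have hlen := congrArg List.length hw
  simp only [List.length_map, List.length_range, List.length_append] at hlen
  obtain ⟨j, hj, hne⟩ := h x.length y.length hpos (by omega)
  apply hne
  have hget : ∀ t, t < n → some (f t) = (x ++ y ++ y ++ z)[t]? := by
    intro t ht
    rw [← hw]
    simp [ht]
  have h1 := hget (x.length + j) (by omega)
  have h2 := hget (x.length + j + y.length) (by omega)
  have e1 : (x ++ y ++ y ++ z)[x.length + j]? = y[j]? := by
    rw [List.append_assoc, List.append_assoc, List.getElem?_append_right (by omega),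
      List.getElem?_append_left (by omega)]
    congr 1; omega
  have e2 : (x ++ y ++ y ++ z)[x.length + j + y.length]? = y[j]? := by
    rw [List.append_assoc, List.getElem?_append_right (by simp),
      List.getElem?_append_left (by simp; omega)]
    congr 1; simp; omega
  rw [e1] at h1
  rw [e2, ← h1] at h2
  exact (Option.some.inj h2).symm

theorem pow_le_sPoly (n k : ℕ) (w : List (Fin 3)) (hw : w.length = n) (hs : SquareFree w)
    (hk : w.count 0 = k) (q : ℝ) (hq : 0 < q) : q ^ k ≤ sPoly n q := by
  have hfin : Finite {w : List (Fin 3) // w.length = n ∧ SquareFree w ∧ w.count 0 = k} :=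
    ((List.finite_length_eq (Fin 3) n).subset (fun w hw => hw.1)).to_subtype
  have hne : Nonempty {w : List (Fin 3) // w.length = n ∧ SquareFree w ∧ w.count 0 = k} :=
    ⟨⟨w, hw, hs, hk⟩⟩
  have h1 : 0 < s2 n k := Nat.card_pos
  have hkn : k ≤ n := by rw [← hk, ← hw]; exact List.count_le_length
  have h2 : (s2 n k : ℝ) * q ^ k ≤ sPoly n q :=
    Finset.single_le_sum (f := fun k => (s2 n k : ℝ) * q ^ k)
      (fun i _ => by positivity) (Finset.mem_range.mpr (by omega))
  have h3 : (1 : ℝ) ≤ s2 n k := by exact_mod_cast h1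
  have h4 : 0 < q ^ k := by positivity
  nlinarith

theorem free_energy_ge (G : Good A B L m o c N) (hL2 : 2 ≤ L) (F : ℝ) (q : ℝ) (hq : 0 < q)
    (hF : Filter.Tendsto (fun n : ℕ => Real.log (sPoly n q) / n) Filter.atTop (nhds F)) :
    (N : ℝ) / L * Real.log q ≤ F := by
  have hsub : Filter.Tendsto (fun k : ℕ => L ^ (k + 1)) Filter.atTop Filter.atTop :=
    (tendsto_pow_atTop_atTop_of_one_lt (by omega)).comp (Filter.tendsto_add_atTop_nat 1)
  refine ge_of_tendsto (hF.comp hsub) (Filter.Eventually.of_forall fun k => ?_)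
  have hs := iterWord_spec G hL2 (k + 1)
  have hw := pow_le_sPoly (L ^ (k + 1)) (N * L ^ k)
    ((List.range (L ^ (k + 1))).map (iterWord A B L (k + 1))) (by simp)
    (squareFree_of_sqFn _ _ hs.2) (by
      rw [count_map_range, pow_succ, mul_comm (L ^ k) L]
      exact image_num G _ _) q hq
  have hlog := Real.log_le_log (by positivity) hw
  rw [Real.log_pow] at hlog
  have hLpos : (0 : ℝ) < L := by exact_mod_cast (by omega : 0 < L)
  simp only [Function.comp_apply]
  rw [le_div_iff₀ (by positivity)]
  refine le_trans (le_of_eq ?_) hlog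
  push_cast
  field_simp
  ring

end

/-- Positions of the letter `a` in the images of the 22-uniform morphism. -/
def maskA22 : Fin 3 → ℕ := ![
  300309,
  346389,
  345237]

/-- Positions of the letter `b` in the images of the 22-uniform morphism. -/
def maskB22 : Fin 3 → ℕ := ![
  1132706,
  1188514,
  1190434]

/-- Positions of the letter `a` in the images of the 699-uniform morphism. -/
def maskA699 : Fin 3 → ℕ := ![
  176022797816413007172654086596665444182596116629740085224673063736384161605354322936505709903687306590863862413443349887405269961914397262158549914595511349648789429348599285822728144055599291469404035818332817,
  176022797816413007172654086596665444182596116629747581583717926362192921841026919817898968127035063080370921167540780504635612154992289199220038337783990784284636525044467607918320121515307490628943157368332945,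
  176022797816413007172654086596665444182596116629747581583717926362192921841026919817898968127035063080370921167540780500018463228163828083169051275604026035039482059403412857674895223425502972509808386732335761]

/-- Positions of the letter `b` in the images of the 699-uniform morphism. -/
def maskB699 : Fin 3 → ℕ := ![
  765763443972665373069148744459421281416667390517776317410076611194982730657539092773587086896092681262082705613151228702644569850622273852846568442535885860102395578953001394265372569095963544317277981848979754,
  765763443972665373069148744459421281416667390517789943326820157228661381205457217216302248494679057204304337411103057653904024598269720624453759767253527006434324441796217240905285190204639010804523701801404714,
  765763443972665373069148744459421281416667390517789943326820157228661381205457217216302248494679057204304337411103057645249057124231691430855209969538853862029620073723816736890579486813485276659410931290818858]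

theorem good22 : Good maskA22 maskB22 22 3 19 10 8 := by
  constructor <;> decide +kernel

theorem good699 : Good maskA699 maskB699 699 5 67 250 192 := by
  constructor <;> decide +kernel

/-- The free energy of ternary square-free words satisfies the lower bound
`F(q) ≥ max{(64/233) log q, (13/36) log q}` for all `q > 0`. -/
theorem ternary_squareFree_free_energy_lower_bound (F : ℝ → ℝ)
    (hF : ∀ q : ℝ, 0 < q →
      Filter.Tendsto (fun n : ℕ => Real.log (sPoly n q) / n) Filter.atTop
        (nhds (F q)))
    (q : ℝ) (hq : 0 < q) :
    max (64 / 233 * Real.log q) (13 / 36 * Real.log q) ≤ F q := by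
  have h1 := free_energy_ge good22 (by norm_num) (F q) q hq (hF q hq)
  have h2 := free_energy_ge good699 (by norm_num) (F q) q hq (hF q hq)
  norm_num at h1 h2
  rcases le_total 0 (Real.log q) with h | h
  · exact max_le (by linarith) (by linarith)
  · exact max_le (by linarith) (by linarith)
end

section
/- The free energy of ternary square-free words is bounded above by F(q) ≤ F(1) + max{ (1780/6481) log q, (469/1201) log q } for all q > 0, where F(1) = lim_{n→∞} (1/n) log s_n = −log x_c is the entropy of ternary square-free words. -/
namespace TSF

/-- Decision trees organising the tests to be performed on a coded word. -/
inductive Trie : Type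
  | leaf (ps : List ℕ) (cs : List (ℕ × ℕ × ℕ)) : Trie
  | node (q : ℕ) (a b c : Trie) : Trie

/-- Evaluate a natural number before passing it on (helps kernel reduction). -/
noncomputable def force (n : ℕ) (k : ℕ → Bool) : Bool :=
  Nat.rec (k 0) (fun m _ => k (Nat.succ m)) n

/-- Selection according to a letter code. -/
noncomputable def sel (d : ℕ) (x y z : Bool) : Bool :=
  @Nat.rec (fun _ => Bool) x (fun d₁ _ => @Nat.rec (fun _ => Bool) x
    (fun d₂ _ => @Nat.rec (fun _ => Bool) y (fun _ _ => z) d₂) d₁) d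

/-- If the coded word `n` ends with a square whose period is in the list, go on with `k`,
otherwise with `e`. -/
noncomputable def sqAny (n : ℕ) (k e : Bool) (ps : List ℕ) : Bool :=
  @List.rec ℕ (fun _ => Bool) e
    (fun p _ ih => @Bool.rec (fun _ => Bool) ih k (Nat.beq (Nat.mod n (Nat.pow 5 p))
      (Nat.mod (Nat.div n (Nat.pow 5 p)) (Nat.pow 5 p)))) ps

/-- If the coded word `n` matches a context whose value is at most `E`, go on with `k`,
otherwise with `e`. -/
noncomputable def ctxAny (n E : ℕ) (k e : Bool) (T : List (ℕ × ℕ × ℕ)) : Bool :=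
  @List.rec (ℕ × ℕ × ℕ) (fun _ => Bool) e
    (fun t _ ih => @Bool.rec (fun _ => Bool) ih
      (@Bool.rec (fun _ => Bool) ih k (Nat.ble t.2.2 E))
      (Nat.beq (Nat.mod n (Nat.pow 5 t.1)) t.2.1)) T

/-- Walk down the decision tree, perform the tests. -/
noncomputable def walk (pl mi n E : ℕ) (k : Bool) (ih : ℕ → Bool) (t : Trie) : Bool :=
  @Trie.rec (fun _ => Bool)
    (fun ps cs => sqAny n k (@Bool.rec (fun _ => Bool) false
        (force (Nat.sub (Nat.add E pl) mi) fun E' => ctxAny n E' k (ih E') cs)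
        (Nat.ble mi (Nat.add E pl))) ps)
    (fun q _ _ _ x y z => sel (Nat.mod (Nat.div n q) 5) x y z) t


/-- One letter is appended. -/
noncomputable def step (pl mi d : ℕ) (t : Trie) (ih : ℕ → ℕ → Bool → Bool)
    (n E : ℕ) (k : Bool) : Bool :=
  force (Nat.add (Nat.mul n 5) d) fun n' => walk pl mi n' E k (fun E' => ih n' E' k) t

/-- Depth-first search (in continuation passing style). -/
noncomputable def dfs (ta tb tc : Trie) (pa ma pb mb : ℕ) (fuel : ℕ) :
    ℕ → ℕ → Bool → Bool :=
  @Nat.rec (fun _ => ℕ → ℕ → Bool → Bool) (fun _ _ _ => false)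
    (fun _ ih n E k => sel (Nat.mod n 5)
      (step pb mb 2 tb ih n E (step pb mb 3 tc ih n E k))
      (step pa ma 1 ta ih n E (step pb mb 3 tc ih n E k))
      (step pa ma 1 ta ih n E (step pb mb 2 tb ih n E k))) fuel

theorem fin3 : ∀ x : Fin 3, x = 0 ∨ x = 1 ∨ x = 2 := by decide

/-- The code of a word (most recent letter first). -/
def enc : List (Fin 3) → ℕ
  | [] => 0
  | x :: l => enc l * 5 + (x.val + 1)

/-- The weight of a word. -/
def cost (pa ma pb mb : ℕ) : List (Fin 3) → ℤ
  | [] => 0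
  | x :: l => (if x = 0 then (pa : ℤ) - ma else (pb : ℤ) - mb) + cost pa ma pb mb l

theorem cost_append (pa ma pb mb : ℕ) (l r : List (Fin 3)) :
    cost pa ma pb mb (l ++ r) = cost pa ma pb mb l + cost pa ma pb mb r := by
  induction l with
  | nil => simp [cost]
  | cons x l ih => simp [cost, ih, add_assoc]

theorem cost_eq (pa ma pb mb : ℕ) (l : List (Fin 3)) :
    cost pa ma pb mb l = ((pa : ℤ) - ma) * (l.count 0 : ℤ)
      + ((pb : ℤ) - mb) * ((l.length : ℤ) - (l.count 0 : ℤ)) := by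
  induction l with
  | nil => simp [cost]
  | cons x l ih =>
    by_cases hx : x = 0
    · subst hx; simp [cost, ih]; ring
    · simp [cost, ih, hx]; ring

theorem enc_pos (x : Fin 3) (l : List (Fin 3)) : 0 < enc (x :: l) := by
  simp [enc]

theorem enc_inj : ∀ l m : List (Fin 3), enc l = enc m → l = m
  | [], [], _ => rfl
  | [], x :: m, h => by have := enc_pos x m; simp [enc] at h
  | x :: l, [], h => by have := enc_pos x l; simp [enc] at h
  | x :: l, y :: m, h => by
    have hx := x.isLt
    have hy := y.isLt
    simp only [enc] at h
    have h1 : enc l = enc m := by omega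
    have h2 : x = y := by apply Fin.ext; omega
    rw [h2, enc_inj l m h1]

theorem enc_take_drop (p : ℕ) : ∀ l : List (Fin 3),
    enc l = enc (l.drop p) * 5 ^ p + enc (l.take p) ∧ enc (l.take p) < 5 ^ p := by
  induction p with
  | zero => intro l; simp [enc]
  | succ p ih =>
    intro l
    cases l with
    | nil => simp [enc]
    | cons x l =>
      obtain ⟨h1, h2⟩ := ih l
      have hx := x.isLt
      simp only [List.drop_succ_cons, List.take_succ_cons, enc]
      constructor
      · rw [h1]; ring
      · rw [pow_succ]; omega

theorem enc_mod (p : ℕ) (l : List (Fin 3)) : enc l % 5 ^ p = enc (l.take p) := by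
  obtain ⟨h1, h2⟩ := enc_take_drop p l
  rw [h1, Nat.mul_add_mod', Nat.mod_eq_of_lt h2]

theorem enc_div (p : ℕ) (l : List (Fin 3)) : enc l / 5 ^ p = enc (l.drop p) := by
  obtain ⟨h1, h2⟩ := enc_take_drop p l
  rw [h1, Nat.add_comm, Nat.add_mul_div_right _ _ (by positivity), Nat.div_eq_of_lt h2, zero_add]

theorem squareFree_of_append {r h : List (Fin 3)} (H : SquareFree (r ++ h)) : SquareFree h := by
  intro x y z e
  exact H (r ++ x) y z (by rw [e]; simp)

/-- A word whose code passes the square test is not square-free. -/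
theorem no_sq {h v : List (Fin 3)} (H : SquareFree h) (hv : v <+: h) (hne : v ≠ []) {p : ℕ}
    (hp : 0 < p) (e : enc v % 5 ^ p = enc v / 5 ^ p % 5 ^ p) : False := by
  rw [enc_div, enc_mod, enc_mod] at e
  have e' := enc_inj _ _ e
  obtain ⟨t, rfl⟩ := hv
  have hz : v = v.take p ++ v.take p ++ (v.drop p).drop p := by
    conv_lhs => rw [← List.take_append_drop p v, ← List.take_append_drop p (v.drop p)]
    rw [← e']; simp
  have := H [] (v.take p) ((v.drop p).drop p ++ t) (by
    conv_lhs => rw [hz]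
    simp)
  rcases List.take_eq_nil_iff.1 this with h0 | h0
  · omega
  · exact hne h0

/-- The bound belonging to a context, for continuations of length at most `N`. -/
def Good (pa ma pb mb N code U : ℕ) : Prop :=
  ∀ r h v : List (Fin 3), r.length ≤ N → SquareFree (r ++ h) → v <+: h → enc v = code →
    0 ≤ (U : ℤ) + cost pa ma pb mb r

/-- The contexts of a decision tree are all in the given list, the periods are positive. -/
def okB (S : List (ℕ × ℕ)) : Trie → Bool
  | .leaf ps cs => ps.all (fun p => Nat.blt 0 p) && cs.all (fun c => S.contains (c.2.1, c.2.2))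
  | .node _ a b c => okB S a && okB S b && okB S c

theorem force_eq (n : ℕ) (k : ℕ → Bool) : force n k = k n := by
  cases n <;> rfl

theorem sel_cases {d : ℕ} {x y z : Bool} : sel d x y z = x ∨ sel d x y z = y ∨ sel d x y z = z := by
  rcases d with _ | _ | _ | d
  · exact Or.inl rfl
  · exact Or.inl rfl
  · exact Or.inr (Or.inl rfl)
  · exact Or.inr (Or.inr rfl)

theorem boolRec_true {b e t : Bool} (h : @Bool.rec (fun _ => Bool) e t b = true) :
    (b = true ∧ t = true) ∨ (b = false ∧ e = true) := by
  cases b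
  · exact Or.inr ⟨rfl, h⟩
  · exact Or.inl ⟨rfl, h⟩

theorem sqAny_true {n : ℕ} {k e : Bool} {ps : List ℕ} (h : sqAny n k e ps = true) :
    (k = true ∧ ∃ p ∈ ps, n % 5 ^ p = n / 5 ^ p % 5 ^ p) ∨ e = true := by
  induction ps with
  | nil => exact Or.inr h
  | cons p ps ih =>
    rcases boolRec_true h with ⟨h1, h2⟩ | ⟨_, h2⟩
    · exact Or.inl ⟨h2, p, by simp, Nat.eq_of_beq_eq_true h1⟩
    · rcases ih h2 with ⟨h3, q, hq, h4⟩ | h3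
      · exact Or.inl ⟨h3, q, by simp [hq], h4⟩
      · exact Or.inr h3

theorem ctxAny_true {n E : ℕ} {k e : Bool} {cs : List (ℕ × ℕ × ℕ)}
    (h : ctxAny n E k e cs = true) :
    (k = true ∧ ∃ c ∈ cs, n % 5 ^ c.1 = c.2.1 ∧ c.2.2 ≤ E) ∨ e = true := by
  induction cs with
  | nil => exact Or.inr h
  | cons c cs ih =>
    have key : ctxAny n E k e cs = true → (k = true ∧ ∃ c' ∈ c :: cs, n % 5 ^ c'.1 = c'.2.1 ∧
        c'.2.2 ≤ E) ∨ e = true := by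
      intro h2
      rcases ih h2 with ⟨h3, q, hq, h4⟩ | h3
      · exact Or.inl ⟨h3, q, by simp [hq], h4⟩
      · exact Or.inr h3
    rcases boolRec_true h with ⟨h1, h2⟩ | ⟨_, h2⟩
    · rcases boolRec_true h2 with ⟨h3, h4⟩ | ⟨_, h4⟩
      · exact Or.inl ⟨h4, c, by simp, Nat.eq_of_beq_eq_true h1, Nat.le_of_ble_eq_true h3⟩
      · exact key h4
    · exact key h2

/-- Soundness of the tests: `r` is the continuation, `v` the known recent part. -/
theorem walk_sound {pa ma pb mb N : ℕ} {S : List (ℕ × ℕ)}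
    (HS : ∀ s ∈ S, Good pa ma pb mb N s.1 s.2) {pl mi E : ℕ} {k : Bool} {ih : ℕ → Bool}
    {r h v : List (Fin 3)} (hr : r.length ≤ N) (hsf : SquareFree (r ++ h)) (hv : v <+: h)
    (hne : v ≠ [])
    (hih : ∀ E', ih E' = true → k = true ∧ 0 ≤ (E' : ℤ) + cost pa ma pb mb r) :
    ∀ t : Trie, okB S t = true → walk pl mi (enc v) E k ih t = true →
      k = true ∧ 0 ≤ (E : ℤ) + pl - mi + cost pa ma pb mb r := by
  intro t
  induction t with
  | node q a b c iha ihb ihc =>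
    intro hok hw
    simp only [okB, Bool.and_eq_true] at hok
    have hw' : sel (Nat.mod (Nat.div (enc v) q) 5) (walk pl mi (enc v) E k ih a)
      (walk pl mi (enc v) E k ih b) (walk pl mi (enc v) E k ih c) = true := hw
    rcases @sel_cases (Nat.mod (Nat.div (enc v) q) 5) (walk pl mi (enc v) E k ih a)
      (walk pl mi (enc v) E k ih b) (walk pl mi (enc v) E k ih c) with h1 | h1 | h1
    · exact iha hok.1.1 (h1 ▸ hw')
    · exact ihb hok.1.2 (h1 ▸ hw')
    · exact ihc hok.2 (h1 ▸ hw')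
  | leaf ps cs =>
    intro hok hw
    simp only [okB, Bool.and_eq_true, List.all_eq_true] at hok
    have hw' : sqAny (enc v) k (@Bool.rec (fun _ => Bool) false
        (force (Nat.sub (Nat.add E pl) mi) fun E' => ctxAny (enc v) E' k (ih E') cs)
        (Nat.ble mi (Nat.add E pl))) ps = true := hw
    rcases sqAny_true hw' with ⟨_, p, hp, h2⟩ | h1
    · exact (no_sq (squareFree_of_append hsf) hv hne (by simpa using hok.1 p hp) h2).elim
    · rcases boolRec_true h1 with ⟨h2, h3⟩ | ⟨_, h3⟩
      · have h2' : mi ≤ E + pl := Nat.le_of_ble_eq_true h2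
        rw [force_eq] at h3
        have hE : ((Nat.sub (Nat.add E pl) mi : ℕ) : ℤ) = (E : ℤ) + pl - mi := by
          have : Nat.sub (Nat.add E pl) mi = E + pl - mi := rfl
          rw [this, Nat.cast_sub h2']; push_cast; ring
        rcases ctxAny_true h3 with ⟨hk, c, hc, h4, h5⟩ | h4
        · refine ⟨hk, ?_⟩
          have hcS : (c.2.1, c.2.2) ∈ S := by simpa using hok.2 c hc
          have := HS _ hcS r h (v.take c.1) hr hsf ((List.take_prefix _ _).trans hv)
            (by rw [← h4, enc_mod])
          have h5' : ((c.2.2 : ℕ) : ℤ) ≤ ((Nat.sub (Nat.add E pl) mi : ℕ) : ℤ) := by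
            exact_mod_cast h5
          rw [hE] at h5'
          simp only at this
          linarith
        · rw [← hE]; exact hih _ h4
      · exact absurd h3 (by simp)

/-- What a successful search gives. -/
def Res (pa ma pb mb M n E : ℕ) : Prop :=
  ∀ r h v : List (Fin 3), r.length ≤ M → SquareFree (r ++ h) → v <+: h → v ≠ [] → enc v = n →
    0 ≤ (E : ℤ) + cost pa ma pb mb r

theorem step_sound {pa ma pb mb N : ℕ} {S : List (ℕ × ℕ)}
    (HS : ∀ s ∈ S, Good pa ma pb mb N s.1 s.2) {pl mi d : ℕ} {t : Trie}
    (ht : okB S t = true) {ih : ℕ → ℕ → Bool → Bool} {n E : ℕ} {k : Bool}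
    (hih : ∀ n' E', ih n' E' k = true → k = true ∧ Res pa ma pb mb N n' E')
    (hst : step pl mi d t ih n E k = true) (x : Fin 3) (hx : x.val + 1 = d)
    (r h v : List (Fin 3)) (hr : r.length ≤ N) (hsf : SquareFree (r ++ x :: h)) (hv : v <+: h)
    (hn : enc v = n) : 0 ≤ (E : ℤ) + pl - mi + cost pa ma pb mb r := by
  unfold step at hst
  rw [force_eq] at hst
  have hn' : Nat.add (Nat.mul n 5) d = enc (x :: v) := by
    simp only [enc, hn, hx]; rfl
  rw [hn'] at hst
  have hv' : x :: v <+: x :: h := by simpa using hv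
  refine (walk_sound HS hr hsf hv' (by simp) (fun E' he => ?_) t ht hst).2
  obtain ⟨h1, h2⟩ := hih _ _ he
  exact ⟨h1, h2 r (x :: h) (x :: v) hr hsf hv' (by simp) rfl⟩

theorem walk_k {pl mi n E : ℕ} {k : Bool} {ih : ℕ → Bool}
    (hih : ∀ E', ih E' = true → k = true) :
    ∀ t : Trie, walk pl mi n E k ih t = true → k = true := by
  intro t
  induction t with
  | node q a b c iha ihb ihc =>
    intro hw
    have hw' : sel (Nat.mod (Nat.div n q) 5) (walk pl mi n E k ih a)
      (walk pl mi n E k ih b) (walk pl mi n E k ih c) = true := hw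
    rcases @sel_cases (Nat.mod (Nat.div n q) 5) (walk pl mi n E k ih a)
      (walk pl mi n E k ih b) (walk pl mi n E k ih c) with h1 | h1 | h1
    · exact iha (h1 ▸ hw')
    · exact ihb (h1 ▸ hw')
    · exact ihc (h1 ▸ hw')
  | leaf ps cs =>
    intro hw
    have hw' : sqAny n k (@Bool.rec (fun _ => Bool) false
        (force (Nat.sub (Nat.add E pl) mi) fun E' => ctxAny n E' k (ih E') cs)
        (Nat.ble mi (Nat.add E pl))) ps = true := hw
    rcases sqAny_true hw' with ⟨hk, _⟩ | h1
    · exact hk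
    · rcases boolRec_true h1 with ⟨h2, h3⟩ | ⟨_, h3⟩
      · rw [force_eq] at h3
        rcases ctxAny_true h3 with ⟨hk, _⟩ | h4
        · exact hk
        · exact hih _ h4
      · exact absurd h3 (by simp)

theorem step_k {pl mi d : ℕ} {t : Trie} {ih : ℕ → ℕ → Bool → Bool} {n E : ℕ} {k : Bool}
    (hih : ∀ n' E', ih n' E' k = true → k = true)
    (hst : step pl mi d t ih n E k = true) : k = true := by
  unfold step at hst
  rw [force_eq] at hst
  exact walk_k (fun E' he => hih _ _ he) t hst

theorem cost_letter (pa ma pb mb : ℕ) (r : List (Fin 3)) (x : Fin 3) :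
    cost pa ma pb mb (r ++ [x]) =
      (if x = 0 then (pa : ℤ) - ma else (pb : ℤ) - mb) + cost pa ma pb mb r := by
  rw [cost_append]; simp [cost]; ring

theorem dfs_sound {pa ma pb mb N : ℕ} {S : List (ℕ × ℕ)}
    (HS : ∀ s ∈ S, Good pa ma pb mb N s.1 s.2) {ta tb tc : Trie}
    (hta : okB S ta = true) (htb : okB S tb = true) (htc : okB S tc = true) (fuel : ℕ) :
    ∀ n E k, dfs ta tb tc pa ma pb mb fuel n E k = true →
      k = true ∧ Res pa ma pb mb (N + 1) n E := by
  induction fuel with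
  | zero => intro n E k h; exact absurd h (by simp [dfs])
  | succ f ih =>
    intro n E k hd
    have ihN : ∀ k n' E', dfs ta tb tc pa ma pb mb f n' E' k = true →
        k = true ∧ Res pa ma pb mb N n' E' := fun k n' E' he =>
      ⟨(ih n' E' k he).1, fun r h v hr => (ih n' E' k he).2 r h v (by omega)⟩
    have ihk : ∀ k n' E', dfs ta tb tc pa ma pb mb f n' E' k = true → k = true :=
      fun k n' E' he => (ih n' E' k he).1
    set I := dfs ta tb tc pa ma pb mb f with hI
    have hd' : sel (Nat.mod n 5)
      (step pb mb 2 tb I n E (step pb mb 3 tc I n E k))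
      (step pa ma 1 ta I n E (step pb mb 3 tc I n E k))
      (step pa ma 1 ta I n E (step pb mb 2 tb I n E k)) = true := hd
    have hk : k = true := by
      rcases @sel_cases (Nat.mod n 5)
        (step pb mb 2 tb I n E (step pb mb 3 tc I n E k))
        (step pa ma 1 ta I n E (step pb mb 3 tc I n E k))
        (step pa ma 1 ta I n E (step pb mb 2 tb I n E k)) with h1 | h1 | h1 <;>
      exact step_k (ihk _) (step_k (ihk _) (h1 ▸ hd'))
    refine ⟨hk, ?_⟩
    intro r h v hr hsf hv hne hn
    rcases List.eq_nil_or_concat r with rfl | ⟨r', x, rfl⟩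
    · simp [cost]
    have hr' : r'.length ≤ N := by simpa using hr
    have hsf' : SquareFree (r' ++ x :: h) := by simpa using hsf
    rw [List.concat_eq_append] at *
    rw [cost_letter]
    obtain ⟨y, w, rfl⟩ := List.exists_cons_of_ne_nil hne
    have hxy : x ≠ y := by
      rintro rfl
      obtain ⟨t, rfl⟩ := hv
      have := hsf' r' [x] (w ++ t) (by simp)
      simp at this
    have hmod : Nat.mod n 5 = y.val + 1 := by
      have hy := y.isLt
      have : n % 5 = y.val + 1 := by rw [← hn]; simp only [enc]; omega
      exact this
    rw [hmod] at hd'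
    have hA : ∀ {k}, step pa ma 1 ta I n E k = true → x = 0 →
        0 ≤ (E : ℤ) + pa - ma + cost pa ma pb mb r' := fun hs hx0 =>
      step_sound HS hta (ihN _) hs x (by rw [hx0]; rfl) r' h (y :: w) hr' hsf' hv hn
    have hB : ∀ {k}, step pb mb 2 tb I n E k = true → x = 1 →
        0 ≤ (E : ℤ) + pb - mb + cost pa ma pb mb r' := fun hs hx0 =>
      step_sound HS htb (ihN _) hs x (by rw [hx0]; rfl) r' h (y :: w) hr' hsf' hv hn
    have hC : ∀ {k}, step pb mb 3 tc I n E k = true → x = 2 →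
        0 ≤ (E : ℤ) + pb - mb + cost pa ma pb mb r' := fun hs hx0 =>
      step_sound HS htc (ihN _) hs x (by rw [hx0]; rfl) r' h (y :: w) hr' hsf' hv hn
    have hx3 : x = 0 ∨ x = 1 ∨ x = 2 := fin3 x
    have hy3 : y = 0 ∨ y = 1 ∨ y = 2 := fin3 y
    rcases hy3 with rfl | rfl | rfl
    · have h1 : step pb mb 2 tb I n E (step pb mb 3 tc I n E k) = true := hd'
      have h2 := step_k (ihk _) h1
      rcases hx3 with rfl | rfl | rfl
      · exact absurd rfl hxy
      · have := hB h1 rfl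
        simp only [Fin.isValue, one_ne_zero, if_false]; linarith
      · have := hC h2 rfl
        rw [if_neg (by decide)]; linarith
    · have h1 : step pa ma 1 ta I n E (step pb mb 3 tc I n E k) = true := hd'
      have h2 := step_k (ihk _) h1
      rcases hx3 with rfl | rfl | rfl
      · have := hA h1 rfl
        rw [if_pos rfl]; linarith
      · exact absurd rfl hxy
      · have := hC h2 rfl
        rw [if_neg (by decide)]; linarith
    · have h1 : step pa ma 1 ta I n E (step pb mb 2 tb I n E k) = true := hd'
      have h2 := step_k (ihk _) h1
      rcases hx3 with rfl | rfl | rfl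
      · have := hA h1 rfl
        rw [if_pos rfl]; linarith
      · have := hB h2 rfl
        rw [if_neg (by decide)]; linarith
      · exact absurd rfl hxy

/-- Run the search from all contexts of a list. -/
noncomputable def runL (ta tb tc : Trie) (pa ma pb mb fuel : ℕ) (S : List (ℕ × ℕ)) : Bool :=
  @List.rec (ℕ × ℕ) (fun _ => Bool) true
    (fun t _ ih => dfs ta tb tc pa ma pb mb fuel t.1 t.2 ih) S

/-- Run the search from the empty context. -/
noncomputable def run0 (ta tb tc : Trie) (pa ma pb mb fuel U : ℕ) : Bool :=
  step pa ma 1 ta (dfs ta tb tc pa ma pb mb fuel) 0 U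
    (step pb mb 2 tb (dfs ta tb tc pa ma pb mb fuel) 0 U
      (step pb mb 3 tc (dfs ta tb tc pa ma pb mb fuel) 0 U true))

theorem runL_sound {pa ma pb mb N : ℕ} {S : List (ℕ × ℕ)}
    (HS : ∀ s ∈ S, Good pa ma pb mb N s.1 s.2) {ta tb tc : Trie}
    (hta : okB S ta = true) (htb : okB S tb = true) (htc : okB S tc = true) (fuel : ℕ) :
    ∀ L : List (ℕ × ℕ), runL ta tb tc pa ma pb mb fuel L = true →
      ∀ s ∈ L, Res pa ma pb mb (N + 1) s.1 s.2 := by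
  intro L
  induction L with
  | nil => simp
  | cons t L ih =>
    intro h
    have h' : dfs ta tb tc pa ma pb mb fuel t.1 t.2 (runL ta tb tc pa ma pb mb fuel L) = true := h
    obtain ⟨h1, h2⟩ := dfs_sound HS hta htb htc fuel _ _ _ h'
    intro s hs
    rcases List.mem_cons.1 hs with rfl | hs
    · exact h2
    · exact ih h1 s hs

theorem run0_sound {pa ma pb mb N : ℕ} {S : List (ℕ × ℕ)}
    (HS : ∀ s ∈ S, Good pa ma pb mb N s.1 s.2) {ta tb tc : Trie}
    (hta : okB S ta = true) (htb : okB S tb = true) (htc : okB S tc = true) (fuel U : ℕ)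
    (hrun : run0 ta tb tc pa ma pb mb fuel U = true) :
    Good pa ma pb mb (N + 1) 0 U := by
  intro r h v hr hsf hv hn
  rcases List.eq_nil_or_concat r with rfl | ⟨r', x, rfl⟩
  · simp [cost]
  have hr' : r'.length ≤ N := by simpa using hr
  have hsf' : SquareFree (r' ++ x :: h) := by simpa using hsf
  rw [List.concat_eq_append] at *
  rw [cost_letter]
  have ih := dfs_sound HS hta htb htc fuel
  have ihN : ∀ k n' E', dfs ta tb tc pa ma pb mb fuel n' E' k = true →
      k = true ∧ Res pa ma pb mb N n' E' := fun k n' E' he =>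
    ⟨(ih n' E' k he).1, fun r h v hr => (ih n' E' k he).2 r h v (by omega)⟩
  have ihk : ∀ k n' E', dfs ta tb tc pa ma pb mb fuel n' E' k = true → k = true :=
    fun k n' E' he => (ih n' E' k he).1
  have h1 := hrun
  unfold run0 at h1
  have h2 := step_k (ihk _) h1
  have h3 := step_k (ihk _) h2
  have hx3 : x = 0 ∨ x = 1 ∨ x = 2 := fin3 x
  rcases hx3 with rfl | rfl | rfl
  · have := step_sound HS hta (ihN _) h1 0 rfl r' h v hr' hsf' hv hn
    rw [if_pos rfl]; linarith
  · have := step_sound HS htb (ihN _) h2 1 rfl r' h v hr' hsf' hv hn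
    rw [if_neg (by decide)]; linarith
  · have := step_sound HS htc (ihN _) h3 2 rfl r' h v hr' hsf' hv hn
    rw [if_neg (by decide)]; linarith

/-- The result of the computation: a bound for the weight of every square-free word. -/
theorem cost_bound {pa ma pb mb : ℕ} {S : List (ℕ × ℕ)} {U : ℕ} {ta tb tc : Trie}
    (hta : okB ((0, U) :: S) ta = true) (htb : okB ((0, U) :: S) tb = true)
    (htc : okB ((0, U) :: S) tc = true) (fuel : ℕ)
    (hpos : ∀ s ∈ S, s.1 ≠ 0)
    (hrun : ∀ s ∈ S, ∃ L, s ∈ L ∧ runL ta tb tc pa ma pb mb fuel L = true)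
    (hrun0 : run0 ta tb tc pa ma pb mb fuel U = true) (w : List (Fin 3)) (hw : SquareFree w) :
    0 ≤ (U : ℤ) + cost pa ma pb mb w := by
  have key : ∀ N, ∀ s ∈ (0, U) :: S, Good pa ma pb mb N s.1 s.2 := by
    intro N
    induction N with
    | zero =>
      intro s _ r h v hr _ _ _
      have : r = [] := List.length_eq_zero_iff.1 (by omega)
      subst this
      simp [cost]
    | succ N ih =>
      intro s hs
      rcases List.mem_cons.1 hs with rfl | hs
      · exact run0_sound ih hta htb htc fuel U hrun0
      · obtain ⟨L, hL, hr⟩ := hrun s hs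
        have := runL_sound ih hta htb htc fuel L hr s hL
        intro r h v h1 h2 h3 h4
        refine this r h v h1 h2 h3 ?_ h4
        rintro rfl
        exact hpos s hs h4.symm
  exact key w.length (0, U) (by simp) w [] [] le_rfl (by simpa using hw) (by simp) rfl

def tAMax : Trie :=
  (.node 5 (.leaf [] []) (.node 25 (.leaf [4, 2, 20] []) (.leaf [] []) (.node 125 (.node 625
  (.leaf [] []) (.leaf [20, 36, 3, 18] [(27, 3474565627028254586, 591), (23, 8264418375910836,
  491)]) (.leaf [105, 67, 210, 420, 13, 840, 118] [])) (.leaf [] []) (.leaf [] []))) (.node 25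
  (.leaf [4, 2, 20] []) (.node 125 (.node 625 (.leaf [] []) (.leaf [105, 67, 210, 420, 13, 840,
  118] []) (.leaf [20, 36, 3, 18] [(27, 4907385609702458316, 591), (23, 6338734975895816, 491)]))
  (.leaf [] []) (.leaf [] [])) (.leaf [] [])))

def tBMax : Trie :=
  (.node 5 (.node 25 (.leaf [] [(1, 2, 1884)]) (.leaf [2, 11, 20] [(4, 432, 1345), (18,
  1291087229182, 995), (14, 2815364182, 1155), (14, 3245432307, 1266)]) (.node 125 (.node 625
  (.leaf [] []) (.node 3125 (.leaf [36, 72, 92, 105, 302, 210, 49, 85, 282] []) (.leaf [] [])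
  (.node 15625 (.leaf [8] []) (.leaf [6, 18] []) (.leaf [] []))) (.leaf [] [])) (.leaf [3] [(31,
  2171603516892659116582, 1067)]) (.leaf [] []))) (.leaf [] []) (.node 25 (.node 125 (.leaf []
  [(1, 2, 1884)]) (.node 625 (.node 3125 (.leaf [] [(1, 2, 1884)]) (.leaf [] []) (.node 15625
  (.node 78125 (.leaf [] []) (.node 390625 (.leaf [] []) (.leaf [] []) (.node 1953125 (.leaf [13,
  85, 18, 11, 302, 1142] []) (.leaf [67, 92, 16] []) (.leaf [] []))) (.leaf [] [])) (.leaf [6]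
  [(13, 358322792, 1199), (9, 900917, 1407)]) (.leaf [] []))) (.leaf [] []) (.leaf [3] [(5, 2167,
  1637)])) (.leaf [6, 8] [(1, 2, 1884)])) (.leaf [] [(1, 2, 1884), (19, 8894888005192, 1735), (13,
  846276442, 1735), (25, 196295521811833317, 1746)]) (.leaf [] [])))

def tCMax : Trie :=
  (.node 5 (.node 25 (.leaf [] [(1, 3, 1884)]) (.node 125 (.node 625 (.leaf [] []) (.leaf [] [])
  (.node 3125 (.leaf [36, 72, 92, 105, 302, 210, 49, 85, 282] []) (.node 15625 (.leaf [8] [])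
  (.leaf [] []) (.leaf [6, 18] [])) (.leaf [] []))) (.leaf [] []) (.leaf [3] [(31,
  3067116006064036447933, 1067)])) (.leaf [2, 11, 20] [(4, 333, 1345), (18, 1170002866583, 995),
  (14, 4075505333, 1155), (14, 4231382208, 1266)])) (.node 25 (.node 125 (.leaf [] [(1, 3, 1884)])
  (.leaf [6, 8] [(1, 3, 1884)]) (.node 625 (.node 3125 (.leaf [] [(1, 3, 1884)]) (.node 15625
  (.node 78125 (.leaf [] []) (.leaf [] []) (.node 390625 (.leaf [] []) (.node 1953125 (.leaf [13,
  11, 18, 85, 302, 1142] []) (.leaf [] []) (.leaf [67, 92, 16] [])) (.leaf [] []))) (.leaf [] [])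
  (.leaf [6] [(13, 405601038, 1199), (9, 1304163, 1407)])) (.leaf [] [])) (.leaf [3] [(5, 1663,
  1637)]) (.leaf [] []))) (.leaf [] []) (.leaf [] [(1, 3, 1884), (19, 12562907160838, 1735), (13,
  649086463, 1735), (25, 138982893873957713, 1746)])) (.leaf [] []))

def tAMin : Trie :=
  (.node 5 (.leaf [] [(0, 0, 9214)]) (.node 25 (.leaf [2] [(0, 0, 9214), (7, 26661, 8576), (14,
  2065807911, 7957)]) (.leaf [] []) (.node 125 (.leaf [3, 6, 30, 13] [(19, 5869790414586, 7883),
  (0, 0, 9214)]) (.node 625 (.node 3125 (.leaf [] []) (.leaf [28, 4] []) (.node 15625 (.leaf [6]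
  []) (.leaf [233, 8, 11, 30] []) (.leaf [] []))) (.leaf [] []) (.leaf [] [])) (.leaf [] [])))
  (.node 25 (.leaf [2] [(0, 0, 9214), (7, 24041, 8576), (14, 1872133416, 7957)]) (.node 125 (.leaf
  [3, 6, 13, 30] [(19, 6509635807691, 7883), (0, 0, 9214)]) (.leaf [] []) (.node 625 (.node 3125
  (.leaf [] []) (.node 15625 (.leaf [6] []) (.leaf [] []) (.leaf [233, 8, 30, 11] [])) (.leaf [28,
  4] [])) (.leaf [] []) (.leaf [] []))) (.leaf [] [])))

def tBMin : Trie :=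
  (.node 5 (.node 25 (.leaf [] []) (.node 125 (.leaf [2] []) (.leaf [] []) (.node 625 (.leaf []
  []) (.leaf [4] [(21, 162740852942307, 2096), (12, 130286057, 5248), (5, 1682, 6154), (24,
  27910379222082932, 2178)]) (.leaf [] []))) (.node 125 (.leaf [] []) (.node 625 (.leaf [233] [(5,
  957, 4514)]) (.leaf [] []) (.node 3125 (.node 15625 (.leaf [] []) (.node 78125 (.leaf [6] [])
  (.leaf [] []) (.leaf [30, 295, 13] [(14, 2083083457, 3177), (28, 11464434403489333457, 4037),
  (9, 1052207, 6153)])) (.leaf [] [])) (.leaf [] []) (.leaf [] []))) (.leaf [] []))) (.leaf [] [])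
  (.node 25 (.node 125 (.leaf [] []) (.leaf [3] [(15, 9391664667, 811)]) (.node 625 (.leaf [] [])
  (.node 3125 (.leaf [124, 295, 18] []) (.leaf [] []) (.leaf [30, 124, 295, 11, 1988] [])) (.leaf
  [] []))) (.node 125 (.node 625 (.leaf [] []) (.leaf [4] [(17, 528190495192, 1810)]) (.node 3125
  (.leaf [] [(11, 32302067, 1824)]) (.leaf [30, 8] []) (.leaf [] []))) (.leaf [] []) (.leaf [2]
  [])) (.leaf [] [])))

def tCMin : Trie :=
  (.node 5 (.node 25 (.leaf [] []) (.node 125 (.leaf [] []) (.leaf [] []) (.node 625 (.leaf [233]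
  [(5, 1058, 4514)]) (.node 3125 (.node 15625 (.leaf [] []) (.leaf [] []) (.node 78125 (.leaf [6]
  []) (.leaf [30, 295, 13] [(14, 1878332933, 3177), (28, 12714132436897864183, 4037), (9, 1379808,
  6153)]) (.leaf [] []))) (.leaf [] []) (.leaf [] [])) (.leaf [] []))) (.node 125 (.leaf [2] [])
  (.node 625 (.leaf [] []) (.leaf [] []) (.leaf [4] [(21, 146744797927208, 2096), (12, 169020958,
  5248), (5, 2208, 6154), (24, 39431406819411583, 2178)])) (.leaf [] []))) (.node 25 (.node 125
  (.leaf [] []) (.node 625 (.leaf [] []) (.leaf [] []) (.node 3125 (.leaf [124, 295, 18] [])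
  (.leaf [30, 124, 295, 11, 1988] []) (.leaf [] []))) (.leaf [3] [(15, 10415417288, 811)])) (.leaf
  [] []) (.node 125 (.node 625 (.leaf [] []) (.node 3125 (.leaf [] [(11, 22863963, 1824)]) (.leaf
  [] []) (.leaf [30, 8] [])) (.leaf [4] [(17, 407143930213, 1810)])) (.leaf [2] []) (.leaf []
  []))) (.leaf [] []))

def sMax0 : List (ℕ × ℕ) :=
  [(358322792, 1199), (1170002866583, 995), (405601038, 1199), (1291087229182, 995), (2815364182,
  1155), (900917, 1407), (8894888005192, 1735), (3474565627028254586, 591),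
  (2171603516892659116582, 1067), (138982893873957713, 1746), (3245432307, 1266),
  (6338734975895816, 491), (649086463, 1735), (1663, 1637), (333, 1345), (12562907160838, 1735),
  (4907385609702458316, 591), (3067116006064036447933, 1067), (196295521811833317, 1746),
  (4075505333, 1155), (1304163, 1407), (432, 1345), (4231382208, 1266), (8264418375910836, 491),
  (846276442, 1735), (2167, 1637)]

theorem runMax0 : runL tAMax tBMax tCMax 0 732 469 0 3000 sMax0 = true := by
  decide +kernel

def sMax1 : List (ℕ × ℕ) :=
  [(2, 1884)]

theorem runMax1 : runL tAMax tBMax tCMax 0 732 469 0 3000 sMax1 = true := by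
  decide +kernel

def sMax2 : List (ℕ × ℕ) :=
  [(3, 1884)]

theorem runMax2 : runL tAMax tBMax tCMax 0 732 469 0 3000 sMax2 = true := by
  decide +kernel

theorem runEMax : run0 tAMax tBMax tCMax 0 732 469 0 3000 7591 = true := by
  decide +kernel

theorem boundMax (w : List (Fin 3)) (hw : SquareFree w) : 0 ≤ ((7591 : ℕ) : ℤ) + cost 0 732 469 0 w := by
  refine cost_bound (S := sMax0 ++ (sMax1 ++ sMax2)) (ta := tAMax) (tb := tBMax) (tc := tCMax)
    (by decide +kernel) (by decide +kernel) (by decide +kernel) 3000 (by decide +kernel) ?_ runEMax w hw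
  intro s hs
  rcases List.mem_append.1 hs with h | h
  · exact ⟨_, h, runMax0⟩
  · rcases List.mem_append.1 h with h | h
    · exact ⟨_, h, runMax1⟩
    · exact ⟨_, h, runMax2⟩

def sMin0 : List (ℕ × ℕ) :=
  [(957, 4514), (1872133416, 7957), (24041, 8576), (5869790414586, 7883), (11464434403489333457,
  4037), (9391664667, 811), (146744797927208, 2096), (2065807911, 7957), (1058, 4514), (26661,
  8576), (162740852942307, 2096), (10415417288, 811), (6509635807691, 7883),
  (12714132436897864183, 4037), (22863963, 1824), (27910379222082932, 2178), (130286057, 5248),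
  (407143930213, 1810), (1682, 6154), (1052207, 6153), (32302067, 1824), (39431406819411583,
  2178), (169020958, 5248), (528190495192, 1810), (1379808, 6153), (2208, 6154)]

theorem runMin0 : runL tAMin tBMin tCMin 4701 0 0 1780 5000 sMin0 = true := by
  decide +kernel

def sMin1 : List (ℕ × ℕ) :=
  [(1878332933, 3177)]

theorem runMin1 : runL tAMin tBMin tCMin 4701 0 0 1780 5000 sMin1 = true := by
  decide +kernel

def sMin2 : List (ℕ × ℕ) :=
  [(2083083457, 3177)]

theorem runMin2 : runL tAMin tBMin tCMin 4701 0 0 1780 5000 sMin2 = true := by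
  decide +kernel

theorem runEMin : run0 tAMin tBMin tCMin 4701 0 0 1780 5000 9214 = true := by
  decide +kernel

theorem boundMin (w : List (Fin 3)) (hw : SquareFree w) : 0 ≤ ((9214 : ℕ) : ℤ) + cost 4701 0 0 1780 w := by
  refine cost_bound (S := sMin0 ++ (sMin1 ++ sMin2)) (ta := tAMin) (tb := tBMin) (tc := tCMin)
    (by decide +kernel) (by decide +kernel) (by decide +kernel) 5000 (by decide +kernel) ?_ runEMin w hw
  intro s hs
  rcases List.mem_append.1 hs with h | h
  · exact ⟨_, h, runMin0⟩
  · rcases List.mem_append.1 h with h | h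
    · exact ⟨_, h, runMin1⟩
    · exact ⟨_, h, runMin2⟩

/-! ### Existence of square-free words of every length -/

/-- The Thue-Morse sequence. -/
def tm (n : ℕ) : ℕ := (Nat.digits 2 n).sum % 2

theorem tm_lt (n : ℕ) : tm n < 2 := Nat.mod_lt _ (by norm_num)

theorem tm_even (n : ℕ) : tm (2 * n) = tm n := by
  rcases Nat.eq_zero_or_pos n with rfl | h
  · rfl
  · unfold tm
    rw [Nat.digits_def' (by norm_num) (by omega)]
    simp

theorem tm_odd (n : ℕ) : tm (2 * n + 1) = 1 - tm n := by
  unfold tm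
  rw [Nat.digits_def' (by norm_num) (by omega)]
  have : (2 * n + 1) / 2 = n := by omega
  rw [this, List.sum_cons]
  omega

theorem tm_no_cube (i : ℕ) (h1 : tm i = tm (i + 1)) (h2 : tm (i + 1) = tm (i + 2)) : False := by
  rcases Nat.even_or_odd' i with ⟨a, rfl | rfl⟩
  · have e1 := tm_even a
    have e2 := tm_odd a
    have := tm_lt a
    omega
  · have e1 := tm_even (a + 1)
    have e2 := tm_odd (a + 1)
    have := tm_lt (a + 1)
    have e3 : 2 * (a + 1) = 2 * a + 1 + 1 := by ring
    have e4 : 2 * (a + 1) + 1 = 2 * a + 1 + 2 := by ring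
    rw [e4] at e2
    rw [e3] at e1
    omega

theorem tm_overlap_free (p : ℕ) : 0 < p → ∀ i, (∀ j ≤ p, tm (i + j) = tm (i + j + p)) → False := by
  induction p using Nat.strong_induction_on with
  | _ p ih =>
  intro hp i H
  rcases Nat.even_or_odd' p with ⟨q, rfl | rfl⟩
  · rcases Nat.even_or_odd' i with ⟨m, rfl | rfl⟩
    · refine ih q (by omega) (by omega) m fun k hk => ?_
      have := H (2 * k) (by omega)
      rw [show 2 * m + 2 * k + 2 * q = 2 * (m + k + q) by ring,
        show 2 * m + 2 * k = 2 * (m + k) by ring, tm_even, tm_even] at this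
      exact this
    · refine ih q (by omega) (by omega) m fun k hk => ?_
      have := H (2 * k) (by omega)
      rw [show 2 * m + 1 + 2 * k + 2 * q = 2 * (m + k + q) + 1 by ring,
        show 2 * m + 1 + 2 * k = 2 * (m + k) + 1 by ring, tm_odd, tm_odd] at this
      have h1 := tm_lt (m + k)
      have h2 := tm_lt (m + k + q)
      omega
  · rcases Nat.eq_zero_or_pos q with rfl | hq
    · have h0 := H 0 (by omega)
      have h1 := H 1 (by omega)
      exact tm_no_cube i (by simpa using h0) (by simpa using h1)
    · rcases Nat.even_or_odd' i with ⟨m, rfl | rfl⟩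
      · have key : ∀ c ≤ 1, tm (m + q + c) = tm (m + q + c + 1) := by
          intro c hc
          have h0 := H (2 * c) (by omega)
          have h1 := H (2 * c + 1) (by omega)
          rw [show 2 * m + 2 * c + (2 * q + 1) = 2 * (m + q + c) + 1 by ring,
            show 2 * m + 2 * c = 2 * (m + c) by ring, tm_even, tm_odd] at h0
          rw [show 2 * m + (2 * c + 1) + (2 * q + 1) = 2 * (m + q + c + 1) by ring,
            show 2 * m + (2 * c + 1) = 2 * (m + c) + 1 by ring, tm_even, tm_odd] at h1
          have h2 := tm_lt (m + c)
          have h3 := tm_lt (m + q + c)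
          have h4 := tm_lt (m + q + c + 1)
          omega
        exact tm_no_cube (m + q) (key 0 (by omega)) (key 1 (by omega))
      · have key : ∀ c ≤ 1, tm (m + c) = tm (m + c + 1) := by
          intro c hc
          have h0 := H (2 * c) (by omega)
          have h1 := H (2 * c + 1) (by omega)
          rw [show 2 * m + 1 + 2 * c + (2 * q + 1) = 2 * (m + q + c + 1) by ring,
            show 2 * m + 1 + 2 * c = 2 * (m + c) + 1 by ring, tm_even, tm_odd] at h0
          rw [show 2 * m + 1 + (2 * c + 1) + (2 * q + 1) = 2 * (m + q + c + 1) + 1 by ring,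
            show 2 * m + 1 + (2 * c + 1) = 2 * (m + c + 1) by ring, tm_even, tm_odd] at h1
          have h2 := tm_lt (m + c)
          have h3 := tm_lt (m + c + 1)
          have h4 := tm_lt (m + q + c + 1)
          omega
        exact tm_no_cube m (key 0 (by omega)) (key 1 (by omega))

/-- The ternary sequence of differences of the Thue-Morse sequence. -/
def vt (n : ℕ) : Fin 3 := ⟨tm (n + 1) + 1 - tm n, by have := tm_lt (n + 1); omega⟩

theorem vt_square_free (p i : ℕ) (hp : 0 < p) (H : ∀ j < p, vt (i + j) = vt (i + j + p)) :
    False := by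
  have hd : ∀ j ≤ p, (tm (i + j) : ℤ) - tm i = tm (i + j + p) - tm (i + p) := by
    intro j
    induction j with
    | zero => intro _; simp
    | succ j ih =>
      intro hj
      have h1 := ih (by omega)
      have h2 := congrArg Fin.val (H j (by omega))
      simp only [vt] at h2
      have e : i + j + p + 1 = i + (j + 1) + p := by ring
      rw [e, add_assoc i j 1] at h2
      have a1 := tm_lt (i + j)
      have a2 := tm_lt (i + j + p)
      omega
  have h0 := hd p le_rfl
  have b1 := tm_lt i
  have b2 := tm_lt (i + p)
  have b3 := tm_lt (i + p + p)
  have he : tm i = tm (i + p) := by omega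
  refine tm_overlap_free p hp i fun j hj => ?_
  have := hd j hj
  omega

theorem exists_squareFree (n : ℕ) : ∃ w : List (Fin 3), w.length = n ∧ SquareFree w := by
  refine ⟨(List.range n).map vt, by simp, ?_⟩
  intro x y z e
  by_contra hy
  have hp : 0 < y.length := List.length_pos_iff.2 hy
  have hl := congrArg List.length e
  simp only [List.length_map, List.length_range, List.length_append] at hl
  refine vt_square_free y.length x.length hp fun j hj => ?_
  have get : ∀ m, m < n → ((List.range n).map vt)[m]? = some (vt m) := by
    intro m hm
    simp [hm]
  have h1 := get (x.length + j) (by omega)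
  have h2 := get (x.length + j + y.length) (by omega)
  rw [e] at h1 h2
  have e1 : (x ++ y ++ y ++ z)[x.length + j]? = y[j]? := by
    rw [List.append_assoc, List.append_assoc, List.getElem?_append_right (by omega),
      List.getElem?_append_left (by omega)]
    congr 1; omega
  have e2 : (x ++ y ++ y ++ z)[x.length + j + y.length]? = y[j]? := by
    rw [List.append_assoc, List.getElem?_append_right (by simp),
      List.getElem?_append_left (by simp; omega)]
    congr 1; simp; omega
  rw [e1] at h1
  rw [e2] at h2
  exact Option.some.inj (h1.symm.trans h2)

/-! ### The free energy -/

instance finite_words (n k : ℕ) :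
    Finite {w : List (Fin 3) // w.length = n ∧ SquareFree w ∧ w.count 0 = k} :=
  ((List.finite_length_eq (Fin 3) n).subset (fun _ hw => hw.1)).to_subtype

theorem s2_ne_zero {n k : ℕ} (h : s2 n k ≠ 0) :
    ∃ w : List (Fin 3), w.length = n ∧ SquareFree w ∧ w.count 0 = k := by
  unfold s2 at h
  by_contra hcon
  push Not at hcon
  apply h
  have : IsEmpty {w : List (Fin 3) // w.length = n ∧ SquareFree w ∧ w.count 0 = k} :=
    ⟨fun w => hcon w.1 w.2.1 w.2.2.1 w.2.2.2⟩
  exact Nat.card_of_isEmpty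

theorem sPoly_pos (n : ℕ) {q : ℝ} (hq : 0 < q) : 0 < sPoly n q := by
  obtain ⟨w, hw, hsf⟩ := exists_squareFree n
  refine Finset.sum_pos' (fun k _ => by positivity) ⟨w.count 0, ?_, ?_⟩
  · have : w.count 0 ≤ w.length := List.count_le_length
    simp; omega
  · have : 0 < s2 n (w.count 0) := by
      unfold s2
      have : Nonempty {w' : List (Fin 3) // w'.length = n ∧ SquareFree w' ∧
        w'.count 0 = w.count 0} := ⟨⟨w, hw, hsf, rfl⟩⟩
      exact Nat.card_pos
    positivity

theorem free_energy_le (F : ℝ → ℝ)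
    (hF : ∀ q : ℝ, 0 < q →
      Filter.Tendsto (fun n : ℕ => Real.log (sPoly n q) / n) Filter.atTop (nhds (F q)))
    (q : ℝ) (hq : 0 < q) (α C : ℝ)
    (H : ∀ n k, s2 n k ≠ 0 → (k : ℝ) * Real.log q ≤ α * n + C) : F q ≤ F 1 + α := by
  have h1 : Filter.Tendsto (fun n : ℕ => Real.log (sPoly n 1) / n + α + C / n) Filter.atTop
      (nhds (F 1 + α + 0)) :=
    ((hF 1 one_pos).add_const α).add (tendsto_const_div_atTop_nhds_zero_nat C)
  rw [add_zero] at h1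
  refine le_of_tendsto_of_tendsto (hF q hq) h1 ?_
  filter_upwards [Filter.eventually_gt_atTop 0] with n hn
  have hn' : (0 : ℝ) < n := by exact_mod_cast hn
  have hle : sPoly n q ≤ Real.exp (α * n + C) * sPoly n 1 := by
    unfold sPoly
    rw [Finset.mul_sum]
    refine Finset.sum_le_sum fun k _ => ?_
    by_cases hk : s2 n k = 0
    · simp [hk]
    · have : q ^ k ≤ Real.exp (α * n + C) := by
        rw [← Real.exp_log hq, ← Real.exp_nat_mul]
        exact Real.exp_le_exp.2 (by simpa using H n k hk)
      rw [one_pow, mul_one, mul_comm]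
      exact mul_le_mul_of_nonneg_right this (by positivity)
  have hlog : Real.log (sPoly n q) ≤ α * n + C + Real.log (sPoly n 1) := by
    have := Real.log_le_log (sPoly_pos n hq) hle
    rwa [Real.log_mul (Real.exp_pos _).ne' (sPoly_pos n one_pos).ne', Real.log_exp] at this
  calc Real.log (sPoly n q) / n ≤ (α * n + C + Real.log (sPoly n 1)) / n := by gcongr
    _ = Real.log (sPoly n 1) / n + α + C / n := by field_simp; ring

end TSF

/-- The free energy of ternary square-free words satisfies the upper bound
`F(q) ≤ F(1) + max{(1780/6481) log q, (469/1201) log q}` for all `q > 0`,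
where `F(1)` is the entropy of ternary square-free words. -/
theorem ternary_squareFree_free_energy_upper_bound (F : ℝ → ℝ)
    (hF : ∀ q : ℝ, 0 < q →
      Filter.Tendsto (fun n : ℕ => Real.log (sPoly n q) / n) Filter.atTop
        (nhds (F q)))
    (q : ℝ) (hq : 0 < q) :
    F q ≤ F 1 + max (1780 / 6481 * Real.log q) (469 / 1201 * Real.log q) := by
  rcases le_total 1 q with h | h
  · have hl : 0 ≤ Real.log q := Real.log_nonneg h
    refine (TSF.free_energy_le F hF q hq (469 / 1201 * Real.log q) (7591 / 1201 * Real.log q)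
      ?_).trans (add_le_add_right (le_max_right _ _) _)
    intro n k hk
    obtain ⟨w, hw, hsf, hc⟩ := TSF.s2_ne_zero hk
    have hb := TSF.boundMax w hsf
    rw [TSF.cost_eq, hw, hc] at hb
    have hb' : (1201 : ℝ) * k ≤ 469 * n + 7591 := by
      have : (1201 : ℤ) * k ≤ 469 * n + 7591 := by push_cast at hb; linarith
      exact_mod_cast this
    have : (k : ℝ) ≤ 469 / 1201 * n + 7591 / 1201 := by linarith
    calc (k : ℝ) * Real.log q ≤ (469 / 1201 * n + 7591 / 1201) * Real.log q := by gcongr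
      _ = _ := by ring
  · have hl : Real.log q ≤ 0 := Real.log_nonpos hq.le h
    refine (TSF.free_energy_le F hF q hq (1780 / 6481 * Real.log q) (-9214 / 6481 * Real.log q)
      ?_).trans (add_le_add_right (le_max_left _ _) _)
    intro n k hk
    obtain ⟨w, hw, hsf, hc⟩ := TSF.s2_ne_zero hk
    have hb := TSF.boundMin w hsf
    rw [TSF.cost_eq, hw, hc] at hb
    have hb' : (1780 : ℝ) * n ≤ 6481 * k + 9214 := by
      have : (1780 : ℤ) * n ≤ 6481 * k + 9214 := by push_cast at hb; linarith
      exact_mod_cast this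
    have : 1780 / 6481 * (n : ℝ) - 9214 / 6481 ≤ k := by linarith
    calc (k : ℝ) * Real.log q ≤ (1780 / 6481 * (n : ℝ) - 9214 / 6481) * Real.log q :=
          mul_le_mul_of_nonpos_right this hl
      _ = _ := by ring
end

section
/- The entropy function of ternary square-free words is strictly positive on the open interval (16/51, 6/17): for every ε with 16/51 < ε < 6/17, P(ε) := inf_{0<q<∞} { F(q) − ε log q } > 0. -/
/-! ### Digits in base four -/

/-- The `t`-th digit of `N` in base four. -/
def dg (N t : ℕ) : ℕ := N / 4 ^ t % 4

lemma dg_ext {a b p : ℕ} (h : ∀ t < p, dg a t = dg b t) : a % 4 ^ p = b % 4 ^ p := by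
  induction p with
  | zero => simp [Nat.mod_one]
  | succ p ih =>
    rw [Nat.mod_pow_succ, Nat.mod_pow_succ, ih (fun t ht => h t (by omega))]
    have := h p (by omega)
    unfold dg at this
    rw [this]

lemma dg_div (N s t : ℕ) : dg (N / 4 ^ s) t = dg N (s + t) := by
  unfold dg
  rw [Nat.div_div_eq_div_mul, pow_add]

lemma dg_cat_lt {A B k t : ℕ} (ht : t < k) : dg (A + 4 ^ k * B) t = dg A t := by
  obtain ⟨m, rfl⟩ := Nat.exists_eq_add_of_lt ht
  unfold dg
  have : 4 ^ (t + m + 1) * B = 4 ^ t * (4 * (4 ^ m * B)) := by ring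
  rw [this, Nat.add_mul_div_left _ _ (by positivity), Nat.add_mul_mod_self_left]

lemma dg_cat_ge {A B k t : ℕ} (hA : A < 4 ^ k) : dg (A + 4 ^ k * B) (k + t) = dg B t := by
  rw [← dg_div, Nat.add_mul_div_left _ _ (by positivity), Nat.div_eq_of_lt hA, zero_add]

/-! ### The blocks of length 29 -/

/-- The six blocks: two for every letter `0, 1, 2`, coded in base four. -/
def cod : ℕ → Bool → ℕ
  | 0, true => 171455169694147716
  | 0, false => 171777017392800900
  | 1, true => 171455133518423172
  | 1, false => 171578278835266692
  | _, true => 163838333288998020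
  | _, false => 171776865238131844

/-- Bounded universal quantifier, as a Boolean. -/
def allB : ℕ → (ℕ → Bool) → Bool
  | 0, _ => true
  | n + 1, f => f n && allB n f

lemma allB_spec {n : ℕ} {f : ℕ → Bool} (h : allB n f = true) : ∀ i < n, f i = true := by
  induction n with
  | zero => intro i hi; omega
  | succ n ih =>
    simp only [allB, Bool.and_eq_true] at h
    intro i hi
    rcases Nat.lt_succ_iff_lt_or_eq.mp hi with h' | rfl
    · exact ih h.2 i h'
    · exact h.1

/-- The word of length 87 coded by `N` has no square. -/
def sqTest (N : ℕ) : Bool :=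
  allB 43 fun p => allB (88 - 2 * (p + 1)) fun s =>
    ! Nat.beq (N / 4 ^ s % 4 ^ (p + 1)) (N / 4 ^ (s + (p + 1)) % 4 ^ (p + 1))

/-- Concatenation of three blocks. -/
def cat3 (X Y Z : ℕ) : ℕ := X + 4 ^ 29 * (Y + 4 ^ 29 * Z)

/-- `V` does not occur in the inside of `X Y`. -/
def syncTest (X Y V : ℕ) : Bool :=
  allB 28 fun d => ! Nat.beq ((X + 4 ^ 29 * Y) / 4 ^ (d + 1) % 4 ^ 29) V

set_option synthInstance.maxHeartbeats 200000 in
set_option synthInstance.maxSize 1000 in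
lemma check_sq : ∀ x < 3, ∀ y < 3, ∀ z < 3, ∀ cx cy cz : Bool, x ≠ y → y ≠ z →
    sqTest (cat3 (cod x cx) (cod y cy) (cod z cz)) = true := by
  decide +kernel

lemma check_sync : ∀ x < 3, ∀ y < 3, ∀ z < 3, ∀ cx cy cz : Bool, x ≠ y →
    syncTest (cod x cx) (cod y cy) (cod z cz) = true := by
  decide +kernel

lemma check_ne : ∀ x < 3, ∀ y < 3, ∀ cx cy : Bool, cod x cx = cod y cy → x = y := by
  decide +kernel

lemma check_lt : ∀ x < 3, ∀ cx : Bool, cod x cx < 4 ^ 29 := by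
  decide +kernel

lemma check_dg : ∀ x < 3, ∀ cx : Bool, ∀ t < 29, dg (cod x cx) t < 3 := by
  decide +kernel

/-- A block as a list of letters. -/
def blk (x : ℕ) (c : Bool) : List (Fin 3) :=
  (List.range 29).map fun r => Fin.ofNat 3 (dg (cod x c) r)

lemma check_count : ∀ x < 3, ∀ cx : Bool, (blk x cx).count 0 = if cx then 11 else 9 := by
  decide +kernel

/-! ### The substitution preserves square-freeness -/

/-- No square among the first `m` values of `w`. -/
def NoSq (w : ℕ → ℕ) (m : ℕ) : Prop :=
  ∀ s p, 0 < p → s + 2 * p ≤ m → ∃ t < p, w (s + t) ≠ w (s + p + t)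

/-- The image of the sequence `w` with choices `c`. -/
def img (w : ℕ → ℕ) (c : ℕ → Bool) (t : ℕ) : ℕ := dg (cod (w (t / 29)) (c (t / 29))) (t % 29)

lemma img_block (w : ℕ → ℕ) (c : ℕ → Bool) (j : ℕ) {r : ℕ} (hr : r < 29) :
    img w c (29 * j + r) = dg (cod (w j) (c j)) r := by
  unfold img
  have h1 : (29 * j + r) / 29 = j := by omega
  have h2 : (29 * j + r) % 29 = r := by omega
  rw [h1, h2]

lemma sqTest_spec {N : ℕ} (h : sqTest N = true) (s p : ℕ) (hp : 0 < p) (hs : s + 2 * p ≤ 87) :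
    ∃ t < p, dg N (s + t) ≠ dg N (s + p + t) := by
  by_contra hcon
  push Not at hcon
  obtain ⟨p, rfl⟩ : ∃ p', p = p' + 1 := ⟨p - 1, by omega⟩
  have h1 := allB_spec (allB_spec h p (by omega)) s (by omega)
  have h2 : N / 4 ^ s % 4 ^ (p + 1) = N / 4 ^ (s + (p + 1)) % 4 ^ (p + 1) := by
    apply dg_ext
    intro t ht
    rw [dg_div, dg_div]
    exact hcon t ht
  rw [h2] at h1
  simp at h1

lemma cat3_0 {X Y Z r : ℕ} (hr : r < 29) : dg (cat3 X Y Z) r = dg X r := dg_cat_lt hr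

lemma cat3_1 {X Y Z r : ℕ} (hX : X < 4 ^ 29) (hr : r < 29) :
    dg (cat3 X Y Z) (29 + r) = dg Y r := by
  unfold cat3
  rw [dg_cat_ge hX, dg_cat_lt hr]

lemma cat3_2 {X Y Z r : ℕ} (hX : X < 4 ^ 29) (hY : Y < 4 ^ 29) :
    dg (cat3 X Y Z) (58 + r) = dg Z r := by
  unfold cat3
  rw [show 58 + r = 29 + (29 + r) by omega, dg_cat_ge hX, dg_cat_ge hY]

/-- Synchronisation: a block only occurs at multiples of 29. -/
lemma sync {w : ℕ → ℕ} {c : ℕ → Bool} {m : ℕ} (hw : ∀ i, w i < 3) (hsq : NoSq w m)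
    {j e : ℕ} (he : e + 29 ≤ 29 * m)
    (h : ∀ r < 29, img w c (29 * j + r) = img w c (e + r)) : 29 ∣ e := by
  by_contra hd
  obtain ⟨i, d, rfl, hd0, hd1⟩ : ∃ i d, e = 29 * i + (d + 1) ∧ 0 < d + 1 ∧ d < 28 :=
    ⟨e / 29, e % 29 - 1, by omega, by omega, by omega⟩
  have hne : w i ≠ w (i + 1) := by
    obtain ⟨t, ht, h1⟩ := hsq i 1 (by omega) (by omega)
    obtain rfl : t = 0 := by omega
    simpa using h1
  have h1 := allB_spec (check_sync _ (hw i) _ (hw (i + 1)) _ (hw j) (c i) (c (i + 1)) (c j) hne)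
    d hd1
  have h2 : (cod (w i) (c i) + 4 ^ 29 * cod (w (i + 1)) (c (i + 1))) / 4 ^ (d + 1) % 4 ^ 29
      = cod (w j) (c j) := by
    rw [← Nat.mod_eq_of_lt (check_lt _ (hw j) (c j))]
    apply dg_ext
    intro t ht
    rw [dg_div, ← img_block w c j ht, h t ht]
    by_cases hlt : d + 1 + t < 29
    · rw [dg_cat_lt hlt, add_assoc (29 * i), img_block w c i hlt]
    · obtain ⟨u, hu⟩ : ∃ u, d + 1 + t = 29 + u := ⟨d + 1 + t - 29, by omega⟩
      rw [hu, dg_cat_ge (check_lt _ (hw i) (c i)),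
        show 29 * i + (d + 1) + t = 29 * (i + 1) + u by omega, img_block w c (i + 1) (by omega)]
  rw [h2] at h1
  simp at h1

/-- Equal blocks come from equal letters. -/
lemma block_inj {w : ℕ → ℕ} {c : ℕ → Bool} (hw : ∀ i, w i < 3) {i j : ℕ}
    (h : ∀ r < 29, img w c (29 * i + r) = img w c (29 * j + r)) : w i = w j := by
  apply check_ne _ (hw i) _ (hw j) (c i) (c j)
  rw [← Nat.mod_eq_of_lt (check_lt _ (hw i) (c i)), ← Nat.mod_eq_of_lt (check_lt _ (hw j) (c j))]
  apply dg_ext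
  intro t ht
  rw [← img_block w c i ht, ← img_block w c j ht, h t ht]

theorem img_noSq {w : ℕ → ℕ} {c : ℕ → Bool} {m : ℕ} (hm : 3 ≤ m) (hw : ∀ i, w i < 3)
    (hsq : NoSq w m) : NoSq (img w c) (29 * m) := by
  intro s p hp hs
  by_contra hcon
  push Not at hcon
  have hadj : ∀ i, i + 2 ≤ m → w i ≠ w (i + 1) := by
    intro i hi
    obtain ⟨t, ht, h1⟩ := hsq i 1 (by omega) (by omega)
    obtain rfl : t = 0 := by omega
    simpa using h1
  obtain ⟨a, b, rfl, hb⟩ : ∃ a b, s = 29 * a + b ∧ b < 29 := ⟨s / 29, s % 29, by omega, by omega⟩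
  by_cases hshort : 29 * a + b + 2 * p ≤ 29 * (a + 3)
  · -- the square lies within three blocks
    obtain ⟨j, hj1, hj2, hj3⟩ : ∃ j, 29 * j ≤ 29 * a + b ∧ 29 * a + b + 2 * p ≤ 29 * (j + 3) ∧
        j + 3 ≤ m := by
      by_cases h : a + 3 ≤ m
      · exact ⟨a, by omega, hshort, h⟩
      · exact ⟨m - 3, by omega, by omega, by omega⟩
    obtain ⟨s, hs'⟩ : ∃ s, 29 * a + b = 29 * j + s := ⟨29 * a + b - 29 * j, by omega⟩
    have hdig : ∀ t < 87, img w c (29 * j + t) = dg (cat3 (cod (w j) (c j))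
        (cod (w (j + 1)) (c (j + 1))) (cod (w (j + 2)) (c (j + 2)))) t := by
      intro t ht
      have hX := check_lt _ (hw j) (c j)
      have hY := check_lt _ (hw (j + 1)) (c (j + 1))
      by_cases h1 : t < 29
      · rw [cat3_0 h1, img_block _ _ _ h1]
      · by_cases h2 : t < 58
        · obtain ⟨u, rfl⟩ : ∃ u, t = 29 + u := ⟨t - 29, by omega⟩
          rw [cat3_1 hX (by omega), show 29 * j + (29 + u) = 29 * (j + 1) + u by omega,
            img_block _ _ _ (by omega)]
        · obtain ⟨u, rfl⟩ : ∃ u, t = 58 + u := ⟨t - 58, by omega⟩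
          rw [cat3_2 hX hY, show 29 * j + (58 + u) = 29 * (j + 2) + u by omega,
            img_block _ _ _ (by omega)]
    obtain ⟨t, ht, h1⟩ := sqTest_spec (check_sq _ (hw j) _ (hw (j + 1)) _ (hw (j + 2)) (c j)
      (c (j + 1)) (c (j + 2)) (hadj j (by omega)) (hadj (j + 1) (by omega))) s p hp (by omega)
    apply h1
    rw [← hdig _ (by omega), ← hdig _ (by omega)]
    have := hcon t ht
    rw [hs'] at this
    rw [← add_assoc, this]
    congr 1
    omega
  · -- the period is a multiple of 29
    have hdvd : 29 ∣ p := by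
      by_cases hmid : 29 * (a + 2) ≤ 29 * a + b + p
      · have := sync (c := c) (j := a + 1) (e := 29 * (a + 1) + p) hw hsq (by omega) (by
          intro r hr
          have := hcon (29 - b + r) (by omega)
          rw [show 29 * a + b + (29 - b + r) = 29 * (a + 1) + r by omega,
            show 29 * a + b + p + (29 - b + r) = 29 * (a + 1) + p + r by omega] at this
          exact this)
        omega
      · have := sync (c := c) (j := a + 2) (e := 29 * (a + 2) - p) hw hsq (by omega) (by
          intro r hr
          have := hcon (29 * (a + 2) + r - (29 * a + b + p)) (by omega)
          rw [show 29 * a + b + p + (29 * (a + 2) + r - (29 * a + b + p))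
              = 29 * (a + 2) + r by omega,
            show 29 * a + b + (29 * (a + 2) + r - (29 * a + b + p))
              = 29 * (a + 2) - p + r by omega] at this
          exact this.symm)
        omega
    obtain ⟨r, rfl⟩ := hdvd
    -- the full blocks inside agree
    have hin : ∀ i, b ≤ 29 * i → i < r → w (a + i) = w (a + r + i) := by
      intro i hi hir
      by_cases hb0 : b = 0 ∨ i + 1 ≤ r
      · apply block_inj (c := c) hw
        intro u hu
        have := hcon (29 * i - b + u) (by omega)
        rw [show 29 * a + b + (29 * i - b + u) = 29 * (a + i) + u by omega,
          show 29 * a + b + 29 * r + (29 * i - b + u) = 29 * (a + r + i) + u by omega] at this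
        exact this
      · omega
    by_cases hb0 : b = 0
    · obtain ⟨t, ht, h1⟩ := hsq a r (by omega) (by omega)
      exact h1 (hin t (by omega) ht)
    · have hxy : w a ≠ w (a + r) := by
        obtain ⟨t, ht, h1⟩ := hsq a r (by omega) (by omega)
        by_cases ht0 : t = 0
        · subst ht0; simpa using h1
        · exact absurd (hin t (by omega) ht) h1
      have hyz : w (a + r) ≠ w (a + 2 * r) := by
        obtain ⟨t, ht, h1⟩ := hsq (a + 1) r (by omega) (by omega)
        by_cases ht0 : t + 1 = r
        · rw [show a + 1 + t = a + r by omega, show a + 1 + r + t = a + 2 * r by omega] at h1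
          exact h1
        · refine absurd (hin (t + 1) (by omega) (by omega)) ?_
          rw [show a + (t + 1) = a + 1 + t by omega,
            show a + r + (t + 1) = a + 1 + r + t by omega]
          exact h1
      have hX := check_lt _ (hw a) (c a)
      have hY := check_lt _ (hw (a + r)) (c (a + r))
      obtain ⟨t, ht, h1⟩ := sqTest_spec (check_sq _ (hw a) _ (hw (a + r)) _ (hw (a + 2 * r)) (c a)
        (c (a + r)) (c (a + 2 * r)) hxy hyz) b 29 (by omega) (by omega)
      apply h1
      by_cases hlt : b + t < 29
      · rw [cat3_0 hlt, show b + 29 + t = 29 + (b + t) by omega, cat3_1 hX hlt,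
          ← img_block w c _ hlt, ← img_block w c _ hlt]
        have := hcon t (by omega)
        rw [show 29 * a + b + t = 29 * a + (b + t) by omega,
          show 29 * a + b + 29 * r + t = 29 * (a + r) + (b + t) by omega] at this
        exact this
      · obtain ⟨u, hu⟩ : ∃ u, b + t = 29 + u := ⟨b + t - 29, by omega⟩
        have hu' : u < 29 := by omega
        rw [hu, cat3_1 hX hu', show b + 29 + t = 58 + u by omega, cat3_2 hX hY,
          ← img_block w c _ hu', ← img_block w c _ hu']
        have := hcon (29 * r - b + u) (by omega)
        rw [show 29 * a + b + (29 * r - b + u) = 29 * (a + r) + u by omega,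
          show 29 * a + b + 29 * r + (29 * r - b + u) = 29 * (a + 2 * r) + u by omega] at this
        exact this

lemma img_lt {w : ℕ → ℕ} {c : ℕ → Bool} (hw : ∀ i, w i < 3) (t : ℕ) : img w c t < 3 :=
  check_dg _ (hw _) _ _ (Nat.mod_lt _ (by norm_num))

/-- There are arbitrarily long square-free words. -/
lemma exists_noSq (m : ℕ) : ∃ w : ℕ → ℕ, (∀ i, w i < 3) ∧ NoSq w m := by
  have key : ∀ n : ℕ, ∃ w : ℕ → ℕ, (∀ i, w i < 3) ∧ NoSq w (n + 3) := by
    intro n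
    induction n with
    | zero =>
      refine ⟨fun i => i % 3, fun i => Nat.mod_lt _ (by norm_num), ?_⟩
      intro s p hp hs
      exact ⟨0, hp, by simp only; omega⟩
    | succ n ih =>
      obtain ⟨w, hw, h⟩ := ih
      refine ⟨img w (fun _ => false), img_lt hw, ?_⟩
      intro s p hp hs
      exact img_noSq (by omega) hw h s p hp (by omega)
  obtain ⟨w, hw, h⟩ := key m
  exact ⟨w, hw, fun s p hp hs => h s p hp (by omega)⟩

/-! ### Words as lists -/

/-- The image word of the first `m` letters, as a list. -/
def word (w : ℕ → ℕ) (c : ℕ → Bool) : ℕ → List (Fin 3)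
  | 0 => []
  | m + 1 => word w c m ++ blk (w m) (c m)

lemma blk_length (x : ℕ) (c : Bool) : (blk x c).length = 29 := by simp [blk]

lemma word_length (w : ℕ → ℕ) (c : ℕ → Bool) (m : ℕ) : (word w c m).length = 29 * m := by
  induction m with
  | zero => rfl
  | succ m ih => rw [word, List.length_append, ih, blk_length]; ring

lemma word_eq (w : ℕ → ℕ) (c : ℕ → Bool) (m : ℕ) :
    word w c m = (List.range (29 * m)).map fun t => Fin.ofNat 3 (img w c t) := by
  induction m with
  | zero => rfl
  | succ m ih =>
    rw [word, ih, show 29 * (m + 1) = 29 * m + 29 by ring, List.range_add, List.map_append,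
      List.map_map]
    congr 1
    unfold blk
    apply List.map_congr_left
    intro r hr
    rw [List.mem_range] at hr
    simp only [Function.comp]
    rw [img_block _ _ _ hr]

lemma squareFree_of_noSq {f : ℕ → ℕ} {n : ℕ} (hf : ∀ i, f i < 3) (h : NoSq f n) :
    SquareFree ((List.range n).map fun t => Fin.ofNat 3 (f t)) := by
  intro x y z hxyz
  by_contra hy
  have hlen := congrArg List.length hxyz
  simp only [List.length_map, List.length_range, List.length_append] at hlen
  have hpos : 0 < y.length := List.length_pos_iff.mpr hy
  obtain ⟨t, ht, hne⟩ := h x.length y.length hpos (by omega)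
  apply hne
  have e1 : ∀ i, i < n → ((List.range n).map fun t => Fin.ofNat 3 (f t))[i]?
      = some (Fin.ofNat 3 (f i)) := by
    intro i hi
    simp [hi]
  have h1 := e1 (x.length + t) (by omega)
  have h2 := e1 (x.length + y.length + t) (by omega)
  rw [hxyz] at h1 h2
  have g1 : (x ++ y ++ y ++ z)[x.length + t]? = y[t]? := by
    rw [List.append_assoc, List.append_assoc, List.getElem?_append_right (by omega),
      List.getElem?_append_left (by omega)]
    congr 1; omega
  have g2 : (x ++ y ++ y ++ z)[x.length + y.length + t]? = y[t]? := by
    rw [List.append_assoc, List.getElem?_append_right (by simp),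
      List.getElem?_append_left (by simp; omega)]
    congr 1; simp
  rw [g1] at h1
  rw [g2, h1] at h2
  have h3 := congrArg Fin.val (Option.some.inj h2)
  simp only [Fin.val_ofNat] at h3
  rwa [Nat.mod_eq_of_lt (hf _), Nat.mod_eq_of_lt (hf _)] at h3

lemma word_count {w : ℕ → ℕ} (c : ℕ → Bool) (hw : ∀ i, w i < 3) (m : ℕ) :
    (word w c m).count 0 = ∑ i ∈ Finset.range m, if c i then 11 else 9 := by
  induction m with
  | zero => rfl
  | succ m ih =>
    rw [word, List.count_append, ih, check_count _ (hw m), Finset.sum_range_succ]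

lemma word_inj {w : ℕ → ℕ} (hw : ∀ i, w i < 3) {c c' : ℕ → Bool} {m : ℕ}
    (h : word w c m = word w c' m) : ∀ i < m, c i = c' i := by
  induction m with
  | zero => intro i hi; omega
  | succ m ih =>
    rw [word, word] at h
    obtain ⟨h1, h2⟩ := List.append_inj h (by rw [word_length, word_length])
    intro i hi
    rcases Nat.lt_succ_iff_lt_or_eq.mp hi with h' | rfl
    · exact ih h1 i h'
    · have h3 := congrArg (List.count 0) h2
      rw [check_count _ (hw i), check_count _ (hw i)] at h3
      revert h3
      cases c i <;> cases c' i <;> simp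

/-- Extend a finite choice sequence. -/
def ext {m : ℕ} (c : Fin m → Bool) (i : ℕ) : Bool := if h : i < m then c ⟨i, h⟩ else false

lemma sPoly_ge (m : ℕ) (hm : 3 ≤ m) (q : ℝ) (hq : 0 < q) :
    (q ^ 9 + q ^ 11) ^ m ≤ sPoly (29 * m) q := by
  classical
  obtain ⟨w, hw, hsq⟩ := exists_noSq m
  let L : (Fin m → Bool) → List (Fin 3) := fun c => word w (ext c) m
  have hlen : ∀ c, (L c).length = 29 * m := fun c => word_length _ _ _
  have hL : ∀ c, SquareFree (L c) := by
    intro c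
    change SquareFree (word w (ext c) m)
    rw [word_eq]
    exact squareFree_of_noSq (img_lt hw) (img_noSq hm hw hsq)
  have hinj : Function.Injective L := by
    intro c c' h
    funext i
    have := word_inj hw h i.1 i.2
    simpa [ext] using this
  have hcard : ∀ k, (Finset.univ.filter fun c => (L c).count 0 = k).card ≤ s2 (29 * m) k := by
    intro k
    have hfin : Finite {v : List (Fin 3) // v.length = 29 * m ∧ SquareFree v ∧ v.count 0 = k} :=
      ((List.finite_length_eq (Fin 3) (29 * m)).subset (fun v hv => hv.1)).to_subtype
    rw [s2, ← Fintype.card_coe, ← Nat.card_eq_fintype_card]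
    refine Nat.card_le_card_of_injective
      (fun c => ⟨L c.1, hlen _, hL _, (Finset.mem_filter.mp c.2).2⟩) ?_
    intro c c' h
    exact Subtype.ext (hinj (congrArg Subtype.val h))
  have hsum : ∑ c, q ^ (L c).count 0 = (q ^ 9 + q ^ 11) ^ m := by
    have h1 : q ^ 9 + q ^ 11 = ∑ b : Bool, q ^ (if b then 11 else 9) := by
      simp [add_comm]
    rw [h1, Fintype.sum_pow]
    apply Finset.sum_congr rfl
    intro c _
    change q ^ (word w (ext c) m).count 0 = _
    rw [word_count _ hw, ← Finset.prod_pow_eq_pow_sum, Finset.prod_range]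
    apply Finset.prod_congr rfl
    intro i _
    simp [ext]
  rw [← hsum, sPoly]
  have hmaps : ∀ c ∈ (Finset.univ : Finset (Fin m → Bool)),
      (L c).count 0 ∈ Finset.range (29 * m + 1) := by
    intro c _
    rw [Finset.mem_range, ← hlen c]
    exact Nat.lt_succ_of_le List.count_le_length
  rw [← Finset.sum_fiberwise_of_maps_to hmaps]
  apply Finset.sum_le_sum
  intro k _
  rw [Finset.sum_congr rfl (g := fun _ => q ^ k)
    (fun c hc => by rw [(Finset.mem_filter.mp hc).2]), Finset.sum_const, nsmul_eq_mul]
  gcongr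
  exact hcard k

lemma F_ge {q l : ℝ} (hq : 0 < q)
    (h : Filter.Tendsto (fun n : ℕ => Real.log (sPoly n q) / n) Filter.atTop (nhds l)) :
    Real.log (q ^ 9 + q ^ 11) / 29 ≤ l := by
  have ht : Filter.Tendsto (fun m : ℕ => 29 * m) Filter.atTop Filter.atTop :=
    Filter.tendsto_id.const_mul_atTop' (by norm_num)
  refine ge_of_tendsto (h.comp ht) ?_
  filter_upwards [Filter.eventually_ge_atTop 3] with m hm
  have hm' : (0 : ℝ) < m := by exact_mod_cast (by omega : 0 < m)
  have h1 := Real.log_le_log (by positivity) (sPoly_ge m hm q hq)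
  rw [Real.log_pow] at h1
  simp only [Function.comp]
  push_cast
  rw [div_le_div_iff₀ (by norm_num) (by positivity)]
  nlinarith

/-- The entropy function `P(ε) = inf_{0<q<∞} {F(q) - ε log q}` of ternary
square-free words is strictly positive on the open interval `(16/51, 6/17)`. -/
theorem ternary_squareFree_entropy_function_positive (F : ℝ → ℝ)
    (hF : ∀ q : ℝ, 0 < q →
      Filter.Tendsto (fun n : ℕ => Real.log (sPoly n q) / n) Filter.atTop
        (nhds (F q)))
    (P : ℝ → ℝ)
    (hP : ∀ ε : ℝ, P ε = ⨅ q : {q : ℝ // 0 < q}, (F q.1 - ε * Real.log q.1))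
    (ε : ℝ) (hε₁ : 16 / 51 < ε) (hε₂ : ε < 6 / 17) :
    0 < P ε := by
  rw [hP]
  have hpos : (0 : ℝ) < Real.log (2 / 1.95) / 29 := by
    have : 0 < Real.log (2 / 1.95) := Real.log_pos (by norm_num)
    positivity
  have : Nonempty {q : ℝ // 0 < q} := ⟨⟨1, one_pos⟩⟩
  refine lt_of_lt_of_le hpos (le_ciInf ?_)
  rintro ⟨q, hq⟩
  have h1 := F_ge hq (hF q hq)
  simp only
  set t := Real.log q with ht
  have hqt : q = Real.exp t := (Real.exp_log hq).symm
  have h2 : q ^ 9 + q ^ 11 = Real.exp (29 * ε * t) *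
      (Real.exp (-(29 * ε - 9) * t) + Real.exp ((11 - 29 * ε) * t)) := by
    rw [hqt, ← Real.exp_nat_mul, ← Real.exp_nat_mul, mul_add, ← Real.exp_add, ← Real.exp_add]
    congr 2 <;> push_cast <;> ring
  have hA := Real.add_one_le_exp (-(29 * ε - 9) * t)
  have hB := Real.add_one_le_exp ((11 - 29 * ε) * t)
  have hA0 := Real.exp_pos (-(29 * ε - 9) * t)
  have hB0 := Real.exp_pos ((11 - 29 * ε) * t)
  set A := Real.exp (-(29 * ε - 9) * t)
  set B := Real.exp ((11 - 29 * ε) * t)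
  have hu : 0 < 29 * ε - 9 := by linarith
  have hv : 0 < 11 - 29 * ε := by linarith
  have h3 : 2 / 1.95 ≤ A + B := by
    have e1 := mul_le_mul_of_nonneg_left hA hv.le
    have e2 := mul_le_mul_of_nonneg_left hB hu.le
    have e3 : (11 - 29 * ε) * A ≤ 1.95 * A :=
      mul_le_mul_of_nonneg_right (by norm_num; linarith) hA0.le
    have e4 : (29 * ε - 9) * B ≤ 1.95 * B :=
      mul_le_mul_of_nonneg_right (by norm_num; linarith) hB0.le
    have e5 : 2 ≤ 1.95 * (A + B) := by linarith
    rw [div_le_iff₀ (by norm_num)]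
    linarith
  have h4 := Real.log_le_log (by norm_num) h3
  rw [h2, Real.log_mul (Real.exp_pos _).ne' (by positivity), Real.log_exp] at h1
  linarith
end
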